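/- Let d ≥ 2 and n ≥ 4, and let δ > 0 with δ < 1/(2⌊n/2⌋²). Set K_4 = 48 and K_n = 36 + 80 · 6^{⌊n/2⌋−2} + 12⌊n/2⌋ for n ≥ 5; set c_n = (n−1)^{n−3} · 2^{C(n−1,2) − n + 3} where C(n−1,2) = (n−1)(n−2)/2; and set ε = 1 − (k−2)/(k−1) + δ if n = 2k is even and ε = 1 − (2k−3)/(2k−1) + δ if n = 2k+1 is odd. Then there exists Q₀ such that for every odd prime power q ≥ Q₀ the following holds. Let Q be a non-degenerate quadratic form on F_q^d with associated distance φ(x,y) = Q(x−y), fix t ∈ F_q \ {0}, let E ⊆ F_q^d, and let C_n^* denote the number of n-tuples (x_1, …, x_n) ∈ E^n of pairwise distinct points with φ(x_i, x_{i+1}) = t for 1 ≤ i ≤ n−1 and φ(x_n, x_1) = t. If |E| ≥ q^{(1/2)(d + 2 − (k−2)/(k−1) + δ)} when n = 2k, respectively |E| ≥ q^{(1/2)(d + 2 − (2k−3)/(2k−1) + δ)} when n = 2k+1, then | C_n^* − |E|^n/q^n | ≤ (|E|^n/q^n) ( K_n q^{−(n/2 − 1)δ} + 2n q^{−2/(n−1)}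 + c_n q^{−(d−3)/2 − ε} ). -/

import Mathlib

open Finset

section StepanovPart
open Polynomial

/-- Distinct degrees: a nontrivial linear combination of monic polynomials is nonzero. -/
lemma cy_comb_ne_zero {E : Type*} [Field E] {ι : Type*} [Fintype ι] (P : ι → E[X])
    (hP : ∀ i, (P i).Monic) (hinj : Function.Injective fun i => (P i).natDegree)
    (a : ι → E) (ha : ∃ i, a i ≠ 0) : ∑ i, C (a i) * P i ≠ 0 := by
  classical
  obtain ⟨i0, hi0⟩ := ha
  intro h0
  have hdeg : ∀ i, a i ≠ 0 → (C (a i) * P i).degree = (P i).natDegree := by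
    intro i hi
    rw [degree_C_mul hi, degree_eq_natDegree (hP i).ne_zero]
  have h := degree_sum_eq_of_disjoint (fun i => C (a i) * P i) Finset.univ (by
    intro i hi j hj hij
    simp only [Function.onFun, Function.comp]
    have hi1 : a i ≠ 0 := by rintro h; simp [h] at hi
    have hj1 : a j ≠ 0 := by rintro h; simp [h] at hj
    rw [hdeg i hi1, hdeg j hj1]
    intro h
    exact hij (hinj (by exact_mod_cast h)))
  have h' : (∑ i, C (a i) * P i).degree = Finset.univ.sup fun i => (C (a i) * P i).degree := h
  rw [h0, degree_zero] at h'
  have h2 : (C (a i0) * P i0).degree ≤ ⊥ := by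
    rw [h']
    exact Finset.le_sup (f := fun i => (C (a i) * P i).degree) (Finset.mem_univ i0)
  rw [hdeg i0 hi0] at h2
  simp at h2

lemma cy_exists_rel {E : Type*} [Field E] {ι : Type*} [Fintype ι] (P : ι → E[X]) (n : ℕ)
    (hP : ∀ i, (P i).natDegree < n) (hn : n < Fintype.card ι) :
    ∃ b : ι → E, (∃ i, b i ≠ 0) ∧ ∑ i, C (b i) * P i = 0 := by
  classical
  have hmem : ∀ i, P i ∈ degreeLT E n := by
    intro i
    rw [mem_degreeLT]
    exact lt_of_le_of_lt degree_le_natDegree (by exact_mod_cast hP i)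
  have : ¬ LinearIndependent E (fun i => (⟨P i, hmem i⟩ : degreeLT E n)) := by
    intro hli
    have : Module.Finite E (degreeLT E n) := Module.Finite.equiv (degreeLTEquiv E n).symm
    have := hli.fintype_card_le_finrank
    rw [(degreeLTEquiv E n).finrank_eq] at this
    simp at this
    omega
  rw [Fintype.not_linearIndependent_iff] at this
  obtain ⟨g, hg, i, hi⟩ := this
  refine ⟨g, ⟨i, hi⟩, ?_⟩
  have := congrArg Subtype.val hg
  simpa [smul_eq_C_mul] using this

lemma cy_stepanov {E : Type*} [Field E] [Fintype E] (p e0 q r s : ℕ) [Fact p.Prime] [CharP E p]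
    (hq : 2 ≤ q) (hr : 1 ≤ r) (hs : s = q * r) (hsp : s = p ^ e0) (hcard : Fintype.card E = s ^ 2)
    (G : E[X]) (hG : G.Monic) (hGd : G.natDegree = 2 * r) (c : E) (S : Finset E)
    (hS : ∀ x ∈ S, x ≠ 0 ∧ (G.eval x) ^ s * x ^ r = x ^ (s * r) * (c * x ^ r - G.eval x)) :
    S.card ≤ s * r + 4 * s := by
  classical
  let ι := Fin r × Fin (r + 3) × Fin q
  let Z : ι → E[X] := fun v =>
    X ^ (s * v.1 + v.2.1 + (q - 1 - v.2.2) * r) * (C c * X ^ r - G) ^ (v.2.2 : ℕ)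
  let W : ι → E[X] := fun v =>
    X ^ (v.1 + s * v.2.1 + (q - 1 - v.2.2) * r) * G ^ (v.2.2 : ℕ)
  have hjr : ∀ j : Fin q, (q - 1 - (j : ℕ)) * r + (j : ℕ) * r + r = s := by
    intro j
    have hj := j.2
    obtain ⟨m, hm⟩ : ∃ m, q = m + 1 + j := ⟨q - 1 - j, by omega⟩
    have h2 : q * r = (m + 1 + j) * r := congrArg (· * r) hm
    rw [hs, show q - 1 - (j : ℕ) = m by omega, h2]; ring
  -- degree bound for Z
  have hZ : ∀ v, (Z v).natDegree < s * r + s - r + 3 := by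
    intro v
    have h1 : (C c * X ^ r - G : E[X]).natDegree ≤ 2 * r := by
      refine (natDegree_sub_le _ _).trans ?_
      rw [hGd]
      refine max_le ((natDegree_C_mul_X_pow_le _ _).trans (by omega)) le_rfl
    have h2 : (Z v).natDegree ≤ (s * v.1 + v.2.1 + (q - 1 - v.2.2) * r) + v.2.2 * (2 * r) := by
      refine natDegree_mul_le.trans ?_
      rw [natDegree_X_pow]
      gcongr
      refine natDegree_pow_le.trans ?_
      gcongr
    have h3 := hjr v.2.2
    have h4 : s * v.1 + s ≤ s * r := by
      have := v.1.2
      calc s * v.1 + s = s * (v.1 + 1) := by ring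
        _ ≤ s * r := by gcongr; omega
    have h5 := v.2.1.2
    have h6 : (v.2.2 : ℕ) * r + r ≤ s := by omega
    have h7 : (v.2.2 : ℕ) * (2 * r) = v.2.2 * r + v.2.2 * r := by ring
    omega
  have hcardι : Fintype.card ι = s * r + 3 * s := by
    simp only [ι, Fintype.card_prod, Fintype.card_fin]
    rw [hs]; ring
  have hrs : 2 * r ≤ s := by rw [hs]; gcongr
  obtain ⟨b, ⟨v0, hv0⟩, hb⟩ := cy_exists_rel Z _ hZ (by rw [hcardι]; omega)
  have hW : ∀ v, (W v).Monic := fun v => (monic_X_pow _).mul (hG.pow _)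
  have hWd : ∀ v, (W v).natDegree = v.1 + s * v.2.1 + (q - 1) * r + v.2.2 * r := by
    intro v
    rw [Monic.natDegree_mul (monic_X_pow _) (hG.pow _), natDegree_X_pow, hG.natDegree_pow, hGd]
    have := v.2.2.2
    obtain ⟨m, hm⟩ : ∃ m, q = m + 1 + v.2.2 := ⟨q - 1 - v.2.2, by omega⟩
    rw [show q - 1 - (v.2.2 : ℕ) = m by omega, show q - 1 = m + v.2.2 by omega]
    ring
  have hinj : Function.Injective fun v => (W v).natDegree := by
    rintro ⟨e, i, j⟩ ⟨e', i', j'⟩ h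
    simp only [hWd] at h
    have he := e.2
    have he' := e'.2
    have h1 : (e : ℕ) + r * (j + q * i) = e' + r * (j' + q * i') := by
      have : ∀ e i j : ℕ, e + r * (j + q * i) = e + s * i + j * r := by
        intro e i j; rw [hs]; ring
      rw [this, this]; omega
    have h2 : (e : ℕ) = e' := by
      have := congrArg (· % r) h1
      simpa [Nat.add_mul_mod_self_left, Nat.mod_eq_of_lt he, Nat.mod_eq_of_lt he'] using this
    have h3 : (j : ℕ) + q * i = j' + q * i' := by
      rw [h2] at h1
      exact Nat.eq_of_mul_eq_mul_left (by omega) (Nat.add_left_cancel h1)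
    have h4 : (j : ℕ) = j' := by
      have := congrArg (· % q) h3
      simpa [Nat.add_mul_mod_self_left, Nat.mod_eq_of_lt j.2, Nat.mod_eq_of_lt j'.2] using this
    have h5 : (i : ℕ) = i' := by
      rw [h4] at h3
      exact Nat.eq_of_mul_eq_mul_left (by omega) (Nat.add_left_cancel h3)
    ext <;> simp [h2, h4, h5]
  let a : ι → E := fun v => b v ^ s
  have hfrob : ∀ x : E, (x ^ s) ^ s = x := by
    intro x
    rw [← pow_mul, ← sq, ← hcard]
    exact FiniteField.pow_card x
  have haW : (∑ v, C (a v) * W v) ≠ 0 :=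
    cy_comb_ne_zero W hW hinj a ⟨v0, pow_ne_zero _ hv0⟩
  have hroot : ∀ x ∈ S, (∑ v, C (a v) * W v).eval x = 0 := by
    intro x hx
    obtain ⟨hx0, hx1⟩ := hS x hx
    have key : x ^ ((q - 1) * r) * ((∑ v, C (a v) * W v).eval x) ^ s
        = x ^ (s * ((q - 1) * r)) * (∑ v, C (b v) * Z v).eval x := by
      rw [eval_finsetSum, eval_finsetSum, hsp, sum_pow_char_pow, ← hsp, Finset.mul_sum,
        Finset.mul_sum]
      refine Finset.sum_congr rfl fun v _ => ?_
      simp only [W, Z, eval_mul, eval_C, eval_pow, eval_X, eval_sub, a, mul_pow, hfrob]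
      have hj := v.2.2.2
      obtain ⟨m, hm⟩ : ∃ m, q = m + 1 + v.2.2 := ⟨q - 1 - v.2.2, by omega⟩
      rw [show q - 1 - (v.2.2 : ℕ) = m by omega, show q - 1 = m + v.2.2 by omega]
      generalize (v.2.2 : ℕ) = j
      generalize (v.2.1 : ℕ) = i
      generalize (v.1 : ℕ) = e
      generalize hy : eval x G = y at *
      have e1 : (x ^ (e + s * i + m * r)) ^ s = x ^ (s * e) * x ^ i * x ^ (s * (m * r)) := by
        have : (x ^ (s * i)) ^ s = x ^ i := by
          rw [mul_comm, pow_mul, hfrob]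
        rw [pow_add, pow_add, mul_pow, mul_pow, this]
        ring
      rw [e1]
      have e2 : x ^ ((m + j) * r) * (b v * (x ^ (s * e) * x ^ i * x ^ (s * (m * r)) * (y ^ j) ^ s))
        = b v * (x ^ (s * e) * x ^ i * x ^ (s * (m * r))) * x ^ (m * r) * (y ^ s * x ^ r) ^ j := by
        ring
      rw [e2, hx1, mul_pow]
      ring
    rw [hb, eval_zero, mul_zero] at key
    have := (mul_eq_zero.mp key).resolve_left (pow_ne_zero _ hx0)
    exact eq_zero_of_pow_eq_zero this
  have hle : S.card ≤ (∑ v, C (a v) * W v).natDegree := by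
    by_contra hlt
    push Not at hlt
    exact haW (eq_zero_of_natDegree_lt_card_of_eval_eq_zero' _ S hroot hlt)
  refine hle.trans ?_
  refine natDegree_sum_le_of_forall_le _ _ ?_
  intro v _
  refine (natDegree_C_mul_le _ _).trans ?_
  rw [hWd]
  have h3 := hjr v.2.2
  have h1 := v.1.2
  have h2 : s * v.2.1 ≤ s * r + 2 * s := by
    have := v.2.1.2
    calc s * (v.2.1 : ℕ) ≤ s * (r + 2) := by gcongr; omega
      _ = _ := by ring
  have h4 : (q - 1) * r + r = s := by
    rw [hs]
    obtain ⟨m, rfl⟩ : ∃ m, q = m + 1 := ⟨q - 1, by omega⟩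
    simp; ring
  omega

end StepanovPart

section KloostermanPart
open Polynomial

lemma cy_trace_count {F E : Type*} [Field F] [Fintype F] [Field E] [Fintype E] [Algebra F E]
    (h : ℕ) (hfr : Module.finrank F E = 2 * (h + 1)) (b c : F) (S : Finset E)
    (hS : ∀ x ∈ S, x ≠ 0 ∧ Algebra.trace F E (x + algebraMap F E b * x⁻¹) = c) :
    S.card ≤ Fintype.card F ^ (h + 1) * Fintype.card F ^ h + 4 * Fintype.card F ^ (h + 1) := by
  classical
  obtain ⟨p, hp⟩ := CharP.exists F
  have hpp : p.Prime := CharP.char_is_prime F p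
  have : Fact p.Prime := ⟨hpp⟩
  have : CharP E p := charP_of_injective_algebraMap (algebraMap F E).injective p
  obtain ⟨⟨n, hn0⟩, -, hn'⟩ := FiniteField.card F p
  have hn : Fintype.card F = p ^ n := hn'
  set q := Fintype.card F with hq
  have hq2 : 2 ≤ q := Fintype.one_lt_card
  set r := q ^ h with hr
  have hs : q ^ (h + 1) = q * r := by rw [hr]; ring
  have hpow : ∀ i, q ^ i = p ^ (n * i) := by intro i; rw [hn, ← pow_mul]
  have hadd : ∀ (i : ℕ) (x y : E), (x + y) ^ q ^ i = x ^ q ^ i + y ^ q ^ i := by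
    intro i x y
    rw [hpow, add_pow_char_pow]
  have hb : ∀ i : ℕ, (algebraMap F E b) ^ q ^ i = algebraMap F E b := by
    intro i
    rw [← map_pow, FiniteField.pow_card_pow]
  set β := algebraMap F E b with hβ
  have hcardE : Fintype.card E = (q ^ (h + 1)) ^ 2 := by
    rw [Module.card_eq_pow_finrank (K := F) (V := E), hfr, ← pow_mul, mul_comm 2]
  let G : E[X] := ∑ i ∈ range (h + 1), (X ^ (r + q ^ i) + C β * X ^ (r - q ^ i))
  have hle : ∀ i ∈ range (h + 1), q ^ i ≤ r := by
    intro i hi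
    exact Nat.pow_le_pow_right (by omega) (by simpa [Nat.lt_succ_iff] using hi)
  have hr1 : 1 ≤ r := Nat.one_le_pow _ _ (by omega)
  have hGeq : G = X ^ (2 * r) + (C β + ∑ i ∈ range h, (X ^ (r + q ^ i) + C β * X ^ (r - q ^ i))) := by
    simp only [G]
    rw [Finset.sum_range_succ, ← hr, Nat.sub_self, two_mul]
    ring
  have hlow : (C β + ∑ i ∈ range h, (X ^ (r + q ^ i) + C β * X ^ (r - q ^ i)) : E[X]).degree
      < ((2 * r : ℕ) : WithBot ℕ) := by
    refine lt_of_le_of_lt (degree_add_le _ _) (max_lt ?_ ?_)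
    · exact lt_of_le_of_lt degree_C_le (by exact_mod_cast (by omega : 0 < 2 * r))
    · refine lt_of_le_of_lt (degree_sum_le _ _) ?_
      rw [Finset.sup_lt_iff (by exact_mod_cast WithBot.bot_lt_coe _)]
      intro i hi
      have h1 : q ^ i < r := Nat.pow_lt_pow_right (by omega) (by simpa using hi)
      refine lt_of_le_of_lt (degree_add_le _ _) (max_lt ?_ ?_)
      · rw [degree_X_pow]; exact_mod_cast (by omega : r + q ^ i < 2 * r)
      · refine lt_of_le_of_lt (degree_C_mul_X_pow_le _ _) ?_
        exact_mod_cast (by omega : r - q ^ i < 2 * r)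
  have hGm : G.Monic := by
    rw [hGeq]
    exact monic_X_pow_add hlow
  have hGd : G.natDegree = 2 * r := by
    rw [hGeq]
    apply natDegree_eq_of_degree_eq_some
    rw [degree_add_eq_left_of_degree_lt, degree_X_pow]
    rw [degree_X_pow]; exact hlow
  refine cy_stepanov p (n * (h + 1)) q r (q ^ (h + 1)) hq2 hr1 hs (hpow _) hcardE G hGm hGd
    (algebraMap F E c) S ?_
  intro x hx
  obtain ⟨hx0, hx1⟩ := hS x hx
  refine ⟨hx0, ?_⟩
  let g : E := ∑ i ∈ range (h + 1), (x + β * x⁻¹) ^ q ^ i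
  have hGg : G.eval x = x ^ r * g := by
    simp only [G, g, eval_finsetSum, Finset.mul_sum]
    refine Finset.sum_congr rfl fun i hi => ?_
    rw [hadd, mul_pow, hb]
    simp only [eval_add, eval_mul, eval_pow, eval_X, eval_C]
    have h1 := hle i hi
    have h2 : x ^ r = x ^ (r - q ^ i) * x ^ q ^ i := by rw [← pow_add]; congr 1; omega
    have h3 : x ^ q ^ i * x⁻¹ ^ q ^ i = 1 := by rw [← mul_pow, mul_inv_cancel₀ hx0, one_pow]
    rw [pow_add, mul_add]
    congr 1
    rw [h2]
    calc β * x ^ (r - q ^ i) = β * x ^ (r - q ^ i) * 1 := by ring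
      _ = _ := by rw [← h3]; ring
  have hgs : g ^ q ^ (h + 1) = algebraMap F E c - g := by
    have ht := FiniteField.algebraMap_trace_eq_sum_pow F E (x + β * x⁻¹)
    rw [hx1, hfr, Nat.card_eq_fintype_card, ← hq, two_mul, Finset.sum_range_add] at ht
    rw [ht]
    simp only [g]
    rw [add_sub_cancel_left]
    conv_lhs => rw [hpow (h + 1), sum_pow_char_pow, ← hpow]
    refine Finset.sum_congr rfl fun i _ => ?_
    rw [← pow_mul, ← pow_add, add_comm i]
  rw [hGg, mul_pow, hgs]
  ring

open Classical in
/-- Kloosterman sum. -/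
noncomputable def cyKl {F : Type*} [Field F] [Fintype F] (ψ : AddChar F ℂ) (b : F) : ℂ :=
  ∑ x : F, if x = 0 then 0 else ψ (x + b * x⁻¹)

lemma cy_norm_char {F : Type*} [Field F] [Fintype F] (ψ : AddChar F ℂ) (x : F) : ‖ψ x‖ = 1 := by
  exact AddChar.norm_apply ψ x

lemma cy_kl_crude {F E : Type*} [Field F] [Fintype F] [Field E] [Fintype E] [Algebra F E]
    (h : ℕ) (hfr : Module.finrank F E = 2 * (h + 1)) (b : F) (ψ : AddChar F ℂ) (hψ : ψ ≠ 1) :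
    ‖cyKl (ψ.compAddMonoidHom (Algebra.trace F E).toAddMonoidHom) (algebraMap F E b)‖
      ≤ 5 * Fintype.card F * Real.sqrt (Fintype.card E) := by
  classical
  set q := Fintype.card F with hq
  set s := q ^ (h + 1) with hs
  have hcardE : Fintype.card E = s ^ 2 := by
    rw [Module.card_eq_pow_finrank (K := F) (V := E), hfr, hs, ← pow_mul, mul_comm 2]
  let S : F → Finset E := fun c => Finset.univ.filter
    (fun x => x ≠ 0 ∧ Algebra.trace F E (x + algebraMap F E b * x⁻¹) = c)
  let B : ℕ := s * q ^ h + 4 * s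
  have hB : ∀ c, (S c).card ≤ B := by
    intro c
    refine cy_trace_count h hfr b c (S c) ?_
    intro x hx
    simpa [S] using hx
  have hsum : cyKl (ψ.compAddMonoidHom (Algebra.trace F E).toAddMonoidHom) (algebraMap F E b)
      = ∑ c, ((S c).card : ℂ) * ψ c := by
    have : ∀ c, ((S c).card : ℂ) * ψ c = ∑ x : E,
        if x ≠ 0 ∧ Algebra.trace F E (x + algebraMap F E b * x⁻¹) = c then ψ c else 0 := by
      intro c
      rw [← Finset.sum_filter, Finset.sum_const, nsmul_eq_mul]
    simp only [this]
    rw [Finset.sum_comm]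
    unfold cyKl
    refine Finset.sum_congr rfl fun x _ => ?_
    by_cases hx : x = 0
    · simp [hx]
    · simp [hx]
  have hcount : ∑ c, (S c).card = s ^ 2 - 1 := by
    have h1 : (Finset.univ.filter (fun x : E => x ≠ 0)).card = s ^ 2 - 1 := by
      rw [Finset.filter_ne' , Finset.card_erase_of_mem (Finset.mem_univ _), Finset.card_univ, hcardE]
    rw [← h1, Finset.card_eq_sum_card_fiberwise
      (f := fun x => Algebra.trace F E (x + algebraMap F E b * x⁻¹)) (t := Finset.univ)]
    · refine Finset.sum_congr rfl fun c _ => ?_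
      simp only [S, Finset.filter_filter]
    · intro x _; simp
  have hs1 : 1 ≤ s := Nat.one_le_pow _ _ (by have : 1 < q := Fintype.one_lt_card; omega)
  have hs2 : 1 ≤ s ^ 2 := Nat.one_le_pow _ _ hs1
  have hψ0 : ∑ c, ψ c = 0 := AddChar.sum_eq_zero_of_ne_one hψ
  have hsum2 : ∑ c, ((S c).card : ℂ) * ψ c = - ∑ c, ((B : ℂ) - (S c).card) * ψ c := by
    simp only [sub_mul, Finset.sum_sub_distrib]
    rw [← Finset.mul_sum, hψ0]; ring
  have hq1 : (1 : ℝ) ≤ q := by exact_mod_cast (Fintype.one_lt_card (α := F)).le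
  rw [hsum, hsum2, norm_neg]
  calc ‖∑ c, ((B : ℂ) - (S c).card) * ψ c‖ ≤ ∑ c, ((B : ℝ) - (S c).card) := by
        refine (norm_sum_le _ _).trans (Finset.sum_le_sum fun c _ => ?_)
        rw [norm_mul, cy_norm_char, mul_one, ← Nat.cast_sub (hB c), Complex.norm_natCast,
          Nat.cast_sub (hB c)]
    _ = q * B - (s ^ 2 - 1 : ℝ) := by
        rw [Finset.sum_sub_distrib, Finset.sum_const, Finset.card_univ, nsmul_eq_mul,
          ← Nat.cast_sum, hcount, Nat.cast_sub hs2]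
        push_cast; rfl
    _ = 4 * q * s + 1 := by
        simp only [B]; push_cast
        have : (s : ℝ) = q * q ^ h := by rw [hs]; push_cast; ring
        rw [this]; ring
    _ ≤ 5 * q * s := by
        have : (1 : ℝ) ≤ s := by exact_mod_cast hs1
        nlinarith
    _ = _ := by
        rw [hcardE]; push_cast
        rw [Real.sqrt_sq (by positivity)]

/-- The two-squares trick. -/
lemma cy_two_squares {F : Type*} [Field F] [Fintype F] (hF : ringChar F ≠ 2) (ν : F)
    (hν : ¬ IsSquare ν) (f : F → ℂ) :
    ∑ v, f (v ^ 2) + ∑ v, f (ν * v ^ 2) = 2 * ∑ a, f a := by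
  classical
  have hν0 : ν ≠ 0 := by rintro rfl; exact hν ⟨0, by simp⟩
  have key : ∀ g : F → ℂ, ∑ v, g (v ^ 2) = ∑ a, ((quadraticChar F a : ℤ) + 1 : ℂ) * g a := by
    intro g
    have : ∀ a, ((quadraticChar F a : ℤ) + 1 : ℂ) * g a
        = ∑ v : F, if v ^ 2 = a then g a else 0 := by
      intro a
      rw [← Finset.sum_filter, Finset.sum_const, nsmul_eq_mul]
      have := quadraticChar_card_sqrts hF a
      have h2 : (({x : F | x ^ 2 = a}.toFinset.card : ℤ) : ℂ) = ((quadraticChar F a + 1 : ℤ) : ℂ) := by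
        rw [this]
      push_cast at h2
      rw [← h2]
      congr 2
      congr 1
      ext x; simp
    simp only [this]
    rw [Finset.sum_comm]
    simp
  rw [key f, key (fun a => f (ν * a))]
  have h2 : ∑ a, ((quadraticChar F a : ℤ) + 1 : ℂ) * f (ν * a)
      = ∑ a, (-(quadraticChar F a : ℤ) + 1 : ℂ) * f a := by
    refine Fintype.sum_equiv (Equiv.mulLeft₀ ν hν0) _ _ ?_
    intro a
    simp only [Equiv.mulLeft₀_apply, map_mul]
    rw [quadraticChar_neg_one_iff_not_isSquare.mpr hν]
    push_cast; ring
  rw [h2, ← Finset.sum_add_distrib, Finset.mul_sum]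
  refine Finset.sum_congr rfl fun a _ => ?_
  ring

end KloostermanPart

section KloostermanPart2

lemma cy_trace_quad {F : Type*} [Field F] (ν : F) (z : QuadraticAlgebra F ν 0) :
    Algebra.trace F (QuadraticAlgebra F ν 0) z = 2 * z.re := by
  rw [Algebra.trace_eq_matrix_trace (QuadraticAlgebra.basis ν 0), Matrix.trace_fin_two,
    Algebra.leftMulMatrix_eq_repr_mul, Algebra.leftMulMatrix_eq_repr_mul]
  have h0 : (QuadraticAlgebra.basis ν (0 : F)) 0 = ⟨1, 0⟩ := by
    apply (QuadraticAlgebra.basis ν (0 : F)).repr.injective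
    ext i
    fin_cases i <;> simp
  have h1 : (QuadraticAlgebra.basis ν (0 : F)) 1 = ⟨0, 1⟩ := by
    apply (QuadraticAlgebra.basis ν (0 : F)).repr.injective
    ext i
    fin_cases i <;> simp
  rw [h0, h1]
  simp
  ring

lemma cy_prim {F : Type*} [Field F] [Fintype F] (ψ : AddChar F ℂ) (hψ : ψ ≠ 1) (c : F)
    (hc : c ≠ 0) : ∑ u, ψ (u * c) = 0 := by
  classical
  have := AddChar.sum_mulShift (ψ := ψ) c (AddChar.IsPrimitive.of_ne_one hψ)
  simpa [hc] using this

lemma cy_doubling {F : Type*} [Field F] [Fintype F] (hF : ringChar F ≠ 2) (ν : F)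
    (hν : ¬ IsSquare ν) [Fact (∀ r : F, r ^ 2 ≠ ν + 0 * r)] [Fintype (QuadraticAlgebra F ν 0)]
    (ψ : AddChar F ℂ) (hψ : ψ ≠ 1) (b : F) (hb : b ≠ 0) :
    cyKl (ψ.compAddMonoidHom (Algebra.trace F (QuadraticAlgebra F ν 0)).toAddMonoidHom)
      (algebraMap F (QuadraticAlgebra F ν 0) b) = 2 * Fintype.card F - (cyKl ψ b) ^ 2 := by
  classical
  have h2 : (2 : F) ≠ 0 := Ring.two_ne_zero hF
  let φ : F → F → ℂ := fun u a => if u ^ 2 - a = 0 then 0 else ψ (2 * u + 2 * u * b * (u ^ 2 - a)⁻¹)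
  have hE : cyKl (ψ.compAddMonoidHom (Algebra.trace F (QuadraticAlgebra F ν 0)).toAddMonoidHom)
      (algebraMap F (QuadraticAlgebra F ν 0) b) = ∑ u, ∑ v, φ u (ν * v ^ 2) := by
    rw [← Fintype.sum_prod_type']
    unfold cyKl
    refine Fintype.sum_equiv (QuadraticAlgebra.equivProd ν 0) _ _ ?_
    intro z
    have hn : z.norm = z.re ^ 2 - ν * z.im ^ 2 := by
      rw [QuadraticAlgebra.norm_def]; ring
    simp only [QuadraticAlgebra.equivProd, Equiv.coe_fn_mk, φ, ← hn,
      QuadraticAlgebra.norm_eq_zero_iff_eq_zero]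
    split_ifs with hz
    · rfl
    · simp only [AddChar.compAddMonoidHom_apply, LinearMap.toAddMonoidHom_coe, cy_trace_quad]
      congr 1
      simp [QuadraticAlgebra.inv_def]
      ring
  have hFF : (cyKl ψ b) ^ 2 = ∑ u, ∑ v, φ u (v ^ 2) := by
    rw [sq]
    unfold cyKl
    rw [Finset.sum_mul_sum, ← Fintype.sum_prod_type', ← Fintype.sum_prod_type']
    symm
    have hbij : Function.Bijective (fun w : F × F => (w.1 + w.2, w.1 - w.2)) := by
      rw [← Finite.injective_iff_bijective]
      rintro ⟨a, b⟩ ⟨c, d⟩ h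
      simp only [Prod.mk.injEq] at h
      have e1 : 2 * a = 2 * c := by linear_combination h.1 + h.2
      have e2 : 2 * b = 2 * d := by linear_combination h.1 - h.2
      rw [mul_left_cancel₀ h2 e1, mul_left_cancel₀ h2 e2]
    refine Fintype.sum_bijective _ hbij _ _ ?_
    rintro ⟨u, v⟩
    simp only [φ]
    have hf : u ^ 2 - v ^ 2 = (u + v) * (u - v) := by ring
    rw [hf]
    by_cases h1 : u + v = 0
    · simp [h1]
    by_cases h3 : u - v = 0
    · simp [h3]
    rw [if_neg (mul_ne_zero h1 h3), if_neg h1, if_neg h3, ← AddChar.map_add_eq_mul]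
    congr 1
    field_simp
    ring
  rw [hE, hFF, eq_sub_iff_add_eq, ← Finset.sum_add_distrib]
  have hstep : ∀ u, ∑ v, φ u (ν * v ^ 2) + ∑ v, φ u (v ^ 2)
      = 2 * ∑ a, if a = 0 then 0 else ψ (u * (2 * (1 + b * a⁻¹))) := by
    intro u
    rw [add_comm, cy_two_squares hF ν hν (φ u)]
    congr 1
    refine Fintype.sum_equiv (Equiv.subLeft (u ^ 2)) _ _ ?_
    intro a
    simp only [φ, Equiv.subLeft_apply]
    split_ifs
    · rfl
    · congr 1; ring
  simp only [hstep]
  rw [← Finset.mul_sum, Finset.sum_comm]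
  congr 1
  rw [Finset.sum_eq_single (-b)]
  · simp [hb]
  · intro a _ ha
    by_cases ha0 : a = 0
    · simp [ha0]
    · simp only [ha0, if_false]
      apply cy_prim ψ hψ
      refine mul_ne_zero h2 ?_
      intro h
      apply ha
      field_simp at h
      linear_combination h
  · simp

lemma cy_weil_tower {F : Type} [Field F] [Fintype F] (hF : ringChar F ≠ 2)
    (ψ : AddChar F ℂ) (hψ : ψ ≠ 1) (b : F) (hb : b ≠ 0) (η : ℝ) (hη : 0 ≤ η)
    (h0 : (2 + η) * Real.sqrt (Fintype.card F) ≤ ‖cyKl ψ b‖) (j : ℕ) :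
    ∃ (E : Type) (_ : Field E) (_ : Fintype E) (_ : Algebra F E),
      Module.finrank F E = 2 ^ j ∧ (2 + 4 ^ j * η) * Real.sqrt (Fintype.card E) ≤
        ‖cyKl (ψ.compAddMonoidHom (Algebra.trace F E).toAddMonoidHom) (algebraMap F E b)‖ := by
  classical
  induction j with
  | zero =>
    refine ⟨F, inferInstance, inferInstance, inferInstance, by simp, ?_⟩
    have : ψ.compAddMonoidHom (Algebra.trace F F).toAddMonoidHom = ψ := by
      ext x
      simp
    rw [this]
    simpa using h0
  | succ j ih =>
    obtain ⟨E, iE, iFE, iA, hfr, hbd⟩ := ih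
    have hE : ringChar E ≠ 2 := by
      have h1 : CharP F (ringChar F) := ringChar.charP F
      have : CharP E (ringChar F) := charP_of_injective_algebraMap (algebraMap F E).injective _
      rw [ringChar.eq E (ringChar F)]
      exact hF
    obtain ⟨ν, hν⟩ := FiniteField.exists_nonsquare hE
    have hfact : Fact (∀ r : E, r ^ 2 ≠ ν + 0 * r) := ⟨by
      intro r hr
      apply hν
      exact ⟨r, by rw [← sq, hr]; ring⟩⟩
    let E2 := QuadraticAlgebra E ν 0
    let iF2 : Fintype E2 := Fintype.ofEquiv _ (QuadraticAlgebra.equivProd ν 0).symm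
    let iA2 : Algebra F E2 := inferInstance
    have itower : IsScalarTower F E E2 := by
      refine IsScalarTower.of_algebraMap_eq' ?_
      rfl
    have hfE : Module.Finite F E := inferInstance
    set ψE := ψ.compAddMonoidHom (Algebra.trace F E).toAddMonoidHom with hψE
    have hψE1 : ψE ≠ 1 := by
      intro h
      apply hψ
      ext x
      obtain ⟨y, hy⟩ := Algebra.trace_surjective F E x
      have := DFunLike.congr_fun h y
      simp only [hψE, AddChar.compAddMonoidHom_apply, LinearMap.toAddMonoidHom_coe, hy] at this
      simpa using this
    have hcomp : ψ.compAddMonoidHom (Algebra.trace F E2).toAddMonoidHom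
        = ψE.compAddMonoidHom (Algebra.trace E E2).toAddMonoidHom := by
      ext x
      simp only [hψE, AddChar.compAddMonoidHom_apply, LinearMap.toAddMonoidHom_coe]
      rw [Algebra.trace_trace]
    have hd := cy_doubling hE ν hν ψE hψE1 (algebraMap F E b)
      (by simpa using hb)
    refine ⟨E2, inferInstance, iF2, iA2, ?_, ?_⟩
    · rw [← Module.finrank_mul_finrank F E E2, hfr, QuadraticAlgebra.finrank_eq_two]; ring
    · rw [hcomp, IsScalarTower.algebraMap_apply F E E2, hd]
      have hcard : Fintype.card E2 = Fintype.card E ^ 2 := by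
        rw [Fintype.card_congr (QuadraticAlgebra.equivProd ν 0), Fintype.card_prod, sq]
      rw [hcard]
      push_cast
      rw [Real.sqrt_sq (by positivity)]
      set k := cyKl ψE (algebraMap F E b)
      set s := Real.sqrt (Fintype.card E)
      have hs : (Fintype.card E : ℝ) = s ^ 2 := by
        simp only [s]; rw [Real.sq_sqrt (by positivity)]
      have h1 : ‖k‖ ^ 2 - 2 * Fintype.card E ≤ ‖(2 * Fintype.card E - k ^ 2 : ℂ)‖ := by
        have := norm_sub_norm_le (k ^ 2) (2 * Fintype.card E : ℂ)
        rw [norm_sub_rev] at this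
        simpa using this
      refine le_trans ?_ h1
      rw [hs]
      have hs0 : 0 ≤ s := Real.sqrt_nonneg _
      have h4 : 0 ≤ (4 : ℝ) ^ j * η := by positivity
      have h3 : ((2 + 4 ^ j * η) * s) ^ 2 ≤ ‖k‖ ^ 2 := by
        gcongr
      rw [pow_succ]
      nlinarith [mul_nonneg (sq_nonneg (4 ^ j * η)) (sq_nonneg s)]

/-- The Weil bound for Kloosterman sums. -/
theorem cy_weil {F : Type} [Field F] [Fintype F] (hF : ringChar F ≠ 2)
    (ψ : AddChar F ℂ) (hψ : ψ ≠ 1) (b : F) (hb : b ≠ 0) :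
    ‖cyKl ψ b‖ ≤ 2 * Real.sqrt (Fintype.card F) := by
  by_contra hlt
  push Not at hlt
  have hs : 0 < Real.sqrt (Fintype.card F) := Real.sqrt_pos.mpr (by exact_mod_cast Fintype.card_pos)
  set η := ‖cyKl ψ b‖ / Real.sqrt (Fintype.card F) - 2 with hη
  have hη0 : 0 < η := by
    rw [hη, sub_pos, lt_div_iff₀ hs]; exact hlt
  obtain ⟨j, hj⟩ := pow_unbounded_of_one_lt (5 * (Fintype.card F : ℝ) / η) (by norm_num : (1 : ℝ) < 4)
  obtain ⟨E, iE, iFE, iA, hfr, hbd⟩ := cy_weil_tower hF ψ hψ b hb η hη0.le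
    (by rw [hη, add_sub_cancel, div_mul_cancel₀ _ hs.ne']) (j + 1)
  have hpow : 1 ≤ 2 ^ j := Nat.one_le_two_pow
  have hcr := cy_kl_crude (F := F) (E := E) (2 ^ j - 1) (by
    rw [hfr, pow_succ]; omega) b ψ hψ
  have hsE : 0 < Real.sqrt (Fintype.card E) :=
    Real.sqrt_pos.mpr (by exact_mod_cast Fintype.card_pos)
  have h1 := le_of_mul_le_mul_right (hbd.trans hcr) hsE
  rw [div_lt_iff₀ hη0] at hj
  rw [pow_succ] at h1
  nlinarith [mul_pos (pow_pos (by norm_num : (0 : ℝ) < 4) j) hη0]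

end KloostermanPart2

section GaussPart

/-- The complex valued quadratic character. -/
noncomputable def cyChi (F : Type*) [Field F] [Fintype F] [DecidableEq F] : MulChar F ℂ :=
  (quadraticChar F).ringHomComp (Int.castRingHom ℂ)

lemma cy_chi_apply {F : Type*} [Field F] [Fintype F] [DecidableEq F] (x : F) :
    cyChi F x = ((quadraticChar F x : ℤ) : ℂ) := rfl

lemma cy_chi_zero {F : Type*} [Field F] [Fintype F] [DecidableEq F] : cyChi F 0 = 0 := by
  simp [cy_chi_apply]

lemma cy_chi_sq {F : Type*} [Field F] [Fintype F] [DecidableEq F] (x : F) (hx : x ≠ 0) :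
    cyChi F x ^ 2 = 1 := by
  rw [cy_chi_apply]
  exact_mod_cast quadraticChar_sq_one hx

lemma cy_chi_norm {F : Type*} [Field F] [Fintype F] [DecidableEq F] (x : F) (hx : x ≠ 0) :
    ‖cyChi F x‖ = 1 := by
  have := congrArg norm (cy_chi_sq x hx)
  rw [norm_pow, norm_one] at this
  exact (pow_eq_one_iff_of_nonneg (norm_nonneg _) (by norm_num)).mp this

lemma cy_chi_ne_one {F : Type*} [Field F] [Fintype F] [DecidableEq F] (hF : ringChar F ≠ 2) :
    cyChi F ≠ 1 := by
  obtain ⟨ν, hν⟩ := FiniteField.exists_nonsquare hF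
  have hν0 : ν ≠ 0 := by rintro rfl; exact hν ⟨0, by simp⟩
  intro h
  have h1 : cyChi F ν = 1 := by rw [h]; exact MulChar.one_apply (isUnit_iff_ne_zero.mpr hν0)
  rw [cy_chi_apply, quadraticChar_neg_one_iff_not_isSquare.mpr hν] at h1
  norm_num at h1

lemma cy_gauss_norm {F : Type*} [Field F] [Fintype F] [DecidableEq F] (hF : ringChar F ≠ 2)
    (ψ : AddChar F ℂ) (hψ : ψ ≠ 1) : ‖gaussSum (cyChi F) ψ‖ = Real.sqrt (Fintype.card F) := by
  have hq : (cyChi F).IsQuadratic := (quadraticChar_isQuadratic F).comp _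
  have h := gaussSum_sq (cy_chi_ne_one hF) hq (AddChar.IsPrimitive.of_ne_one hψ)
  have h2 := congrArg norm h
  rw [norm_pow, norm_mul, cy_chi_norm _ (by simp), one_mul, Complex.norm_natCast] at h2
  rw [← h2, Real.sqrt_sq (norm_nonneg _)]

lemma cy_gauss_shift {F : Type*} [Field F] [Fintype F] [DecidableEq F]
    (ψ : AddChar F ℂ) (c : F) (hc : c ≠ 0) :
    ∑ x, cyChi F x * ψ (c * x) = cyChi F c * gaussSum (cyChi F) ψ := by
  have h := gaussSum_mulShift (cyChi F) ψ (Units.mk0 c hc)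
  rw [Units.val_mk0] at h
  rw [← h, ← mul_assoc, ← sq, cy_chi_sq c hc, one_mul]
  rfl

lemma cy_sum_sq {F : Type*} [Field F] [Fintype F] [DecidableEq F] (hF : ringChar F ≠ 2)
    (g : F → ℂ) : ∑ v, g (v ^ 2) = ∑ a, (cyChi F a + 1) * g a := by
  have : ∀ a, (cyChi F a + 1) * g a = ∑ v : F, if v ^ 2 = a then g a else 0 := by
    intro a
    rw [← Finset.sum_filter, Finset.sum_const, nsmul_eq_mul]
    have := quadraticChar_card_sqrts hF a
    have h2 : (({x : F | x ^ 2 = a}.toFinset.card : ℤ) : ℂ) = ((quadraticChar F a + 1 : ℤ) : ℂ) := by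
      rw [this]
    push_cast at h2
    rw [cy_chi_apply, ← h2]
    congr 2
    congr 1
    ext x; simp
  simp only [this]
  rw [Finset.sum_comm]
  simp

lemma cy_gauss_quad {F : Type*} [Field F] [Fintype F] [DecidableEq F] (hF : ringChar F ≠ 2)
    (ψ : AddChar F ℂ) (hψ : ψ ≠ 1) (c : F) (hc : c ≠ 0) :
    ∑ z, ψ (c * z ^ 2) = cyChi F c * gaussSum (cyChi F) ψ := by
  rw [cy_sum_sq hF (fun a => ψ (c * a)), ← cy_gauss_shift ψ c hc]
  simp only [add_mul, one_mul, Finset.sum_add_distrib]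
  have : ∑ x, ψ (c * x) = 0 := by
    simp only [mul_comm c]
    exact cy_prim ψ hψ c hc
  rw [this, add_zero]

/-- Salié sum bound. -/
lemma cy_salie {F : Type*} [Field F] [Fintype F] [DecidableEq F] (hF : ringChar F ≠ 2)
    (ψ : AddChar F ℂ) (hψ : ψ ≠ 1) (b : F) :
    ‖∑ x, cyChi F x * ψ (x + b * x⁻¹)‖ ≤ 2 * Real.sqrt (Fintype.card F) := by
  have h2 : (2 : F) ≠ 0 := Ring.two_ne_zero hF
  have hsq : 0 ≤ Real.sqrt (Fintype.card F) := Real.sqrt_nonneg _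
  by_cases hb : b = 0
  · have : ∑ x, cyChi F x * ψ (x + b * x⁻¹) = gaussSum (cyChi F) ψ := by
      simp [hb, gaussSum]
    rw [this, cy_gauss_norm hF ψ hψ]
    linarith
  by_cases hbs : IsSquare b
  · obtain ⟨r, hr⟩ := hbs
    have hr0 : r ≠ 0 := by rintro rfl; simp at hr; exact hb hr
    have hT : ∑ x, cyChi F x * ψ (x + b * x⁻¹)
        = cyChi F r * ∑ x, cyChi F x * ψ (r * (x + x⁻¹)) := by
      rw [Finset.mul_sum]
      symm
      refine Fintype.sum_equiv (Equiv.mulLeft₀ r hr0) _ _ ?_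
      intro x
      simp only [Equiv.mulLeft₀_apply, map_mul, mul_assoc]
      congr 3
      rw [hr]
      by_cases hx : x = 0
      · simp [hx]
      · field_simp
    have hcnt : ∀ g : F → ℂ, ∑ x, (if x = 0 then 0 else g (x + x⁻¹))
        = ∑ y, (cyChi F (y ^ 2 - 4) + 1) * g y := by
      intro g
      have : ∀ y, (cyChi F (y ^ 2 - 4) + 1) * g y
          = ∑ x : F, if x ≠ 0 ∧ x + x⁻¹ = y then g y else 0 := by
        intro y
        rw [← Finset.sum_filter, Finset.sum_const, nsmul_eq_mul]
        have h1 := quadraticChar_card_sqrts hF (y ^ 2 - 4)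
        have h3 : (({x : F | x ^ 2 = y ^ 2 - 4}.toFinset.card : ℤ) : ℂ)
            = ((quadraticChar F (y ^ 2 - 4) + 1 : ℤ) : ℂ) := by
          rw [h1]
        push_cast at h3
        rw [cy_chi_apply, ← h3]
        congr 2
        symm
        refine Finset.card_bij (fun x _ => 2 * x - y) ?_ ?_ ?_
        · intro x hx
          simp only [Finset.mem_filter, Finset.mem_univ, true_and] at hx
          simp only [Set.mem_toFinset, Set.mem_ofPred_eq]
          obtain ⟨hx0, rfl⟩ := hx
          field_simp
          ring
        · intro x _ x' _ h
          have : 2 * x = 2 * x' := by linear_combination h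
          exact mul_left_cancel₀ h2 this
        · intro w hw
          simp only [Set.mem_toFinset, Set.mem_ofPred_eq] at hw
          have h4 : (w + y) * (y - w) = 4 := by linear_combination -hw
          have h40 : (4 : F) ≠ 0 := by
            have : (4 : F) = 2 * 2 := by norm_num
            rw [this]; exact mul_ne_zero h2 h2
          have hwy : w + y ≠ 0 := by rintro h; rw [h, zero_mul] at h4; exact h40 h4.symm
          refine ⟨(w + y) / 2, ?_, ?_⟩
          · simp only [Finset.mem_filter, Finset.mem_univ, true_and]
            refine ⟨div_ne_zero hwy h2, ?_⟩
            field_simp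
            linear_combination hw
          · field_simp; ring
      simp only [this]
      rw [Finset.sum_comm]
      refine Finset.sum_congr rfl fun x _ => ?_
      by_cases hx : x = 0
      · simp [hx]
      · simp [hx]
    have hchi4 : ∀ x : F, x ≠ 0 → cyChi F (x ^ 2) = 1 := by
      intro x hx; rw [map_pow, cy_chi_sq x hx]
    have hmain : ∑ x, cyChi F x * ψ (r * (x + x⁻¹))
        = ∑ y, cyChi F (y + 2) * ψ (r * y) + ∑ y, cyChi F (y - 2) * ψ (r * y) := by
      have e1 := hcnt (fun y => cyChi F (y + 2) * ψ (r * y))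
      have e2 : ∑ x : F, (if x = 0 then 0 else cyChi F (x + x⁻¹ + 2) * ψ (r * (x + x⁻¹)))
          = ∑ x, (cyChi F x * ψ (r * (x + x⁻¹))
              - if x = -1 then cyChi F (-1) * ψ (r * (-2)) else 0) := by
        refine Finset.sum_congr rfl fun x _ => ?_
        by_cases hx : x = 0
        · subst hx
          simp [cy_chi_zero]
        by_cases hx1 : x = -1
        · subst hx1
          have : (-1 : F) + (-1)⁻¹ = -2 := by norm_num
          rw [this]
          simp [cy_chi_zero]
        · rw [if_neg hx, if_neg hx1, sub_zero]
          congr 1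
          have hx1' : x + 1 ≠ 0 := by rintro h; apply hx1; linear_combination h
          have : x + x⁻¹ + 2 = (x + 1) ^ 2 * (x⁻¹ ^ 2 * x) := by field_simp; ring
          rw [this, map_mul, map_mul, hchi4 _ hx1', hchi4 _ (inv_ne_zero hx), one_mul, one_mul]
      have e3 : ∑ y : F, (cyChi F (y ^ 2 - 4) + 1) * (cyChi F (y + 2) * ψ (r * y))
          = ∑ y, (cyChi F (y + 2) * ψ (r * y) + cyChi F (y - 2) * ψ (r * y)
              - if y = -2 then cyChi F (-1) * ψ (r * (-2)) else 0) := by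
        refine Finset.sum_congr rfl fun y _ => ?_
        have hf : y ^ 2 - 4 = (y - 2) * (y + 2) := by ring
        by_cases hy : y = -2
        · subst hy
          have : (-2 : F) - 2 = 2 ^ 2 * (-1) := by norm_num
          have hc : cyChi F ((-2 : F) - 2) = cyChi F (-1) := by
            rw [this, map_mul, hchi4 2 h2, one_mul]
          rw [hc]
          simp [cy_chi_zero]
        · have hy2 : y + 2 ≠ 0 := by rintro h; apply hy; linear_combination h
          rw [if_neg hy, hf, map_mul]
          have := cy_chi_sq _ hy2
          linear_combination (cyChi F (y - 2) * ψ (r * y)) * this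
      rw [e2, e3] at e1
      simp only [Finset.sum_sub_distrib, Finset.sum_add_distrib, Finset.sum_ite_eq',
        Finset.mem_univ, if_true] at e1
      linear_combination e1
    have hs1 : ∀ c : F, ‖∑ y, cyChi F (y + c) * ψ (r * y)‖ = Real.sqrt (Fintype.card F) := by
      intro c
      have : ∑ y, cyChi F (y + c) * ψ (r * y) = ψ (-(r * c)) * ∑ y, cyChi F y * ψ (r * y) := by
        rw [Finset.mul_sum]
        refine Fintype.sum_equiv (Equiv.addRight c) _ _ ?_
        intro y
        simp only [Equiv.coe_addRight]
        rw [mul_left_comm, ← AddChar.map_add_eq_mul]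
        congr 2; ring
      rw [this, norm_mul, AddChar.norm_apply, one_mul, cy_gauss_shift ψ r hr0, norm_mul,
        cy_chi_norm r hr0, one_mul, cy_gauss_norm hF ψ hψ]
    rw [hT, norm_mul, cy_chi_norm r hr0, one_mul, hmain, two_mul]
    refine (norm_add_le _ _).trans ?_
    refine add_le_add (hs1 2).le ?_
    have := hs1 (-2)
    simp only [← sub_eq_add_neg] at this
    exact this.le
  · have hT : ∑ x, cyChi F x * ψ (x + b * x⁻¹) = -∑ x, cyChi F x * ψ (x + b * x⁻¹) := by
      rw [← Finset.sum_neg_distrib]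
      have hbij : Function.Bijective (fun x : F => b * x⁻¹) := by
        rw [← Finite.injective_iff_bijective]
        intro x y h
        exact inv_injective (mul_left_cancel₀ hb h)
      refine Fintype.sum_bijective _ hbij _ _ ?_
      intro x
      by_cases hx : x = 0
      · simp [hx, cy_chi_zero]
      have h1 : cyChi F (b * x⁻¹) = - cyChi F x := by
        have e : b * x⁻¹ = b * (x⁻¹ ^ 2 * x) := by field_simp
        rw [e, map_mul, map_mul, map_pow, cy_chi_sq _ (inv_ne_zero hx), one_mul, cy_chi_apply b,
          quadraticChar_neg_one_iff_not_isSquare.mpr hbs]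
        push_cast; ring
      rw [h1, neg_mul, neg_neg]
      congr 2
      field_simp
      ring
    have : ∑ x, cyChi F x * ψ (x + b * x⁻¹) = 0 := by
      linear_combination (1 / 2 : ℂ) * hT
    rw [this, norm_zero]
    positivity

end GaussPart

section FourierPart

lemma cy_char_sum {F ι : Type*} [Field F] (ψ : AddChar F ℂ) (s : Finset ι) (f : ι → F) :
    ψ (∑ i ∈ s, f i) = ∏ i ∈ s, ψ (f i) := by
  classical
  induction s using Finset.induction_on with
  | empty => simp
  | insert a s ha ih => rw [Finset.sum_insert ha, Finset.prod_insert ha, AddChar.map_add_eq_mul, ih]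

open Classical in
lemma cy_form_gauss {F : Type} [Field F] [Fintype F] (hF : ringChar F ≠ 2)
    (ψ : AddChar F ℂ) (hψ : ψ ≠ 1) {d : ℕ} (Q : QuadraticForm F (Fin d → F))
    (hQ : ∀ x, (∀ y, QuadraticMap.polar (⇑Q) x y = 0) → x = 0) :
    ∃ g0 : ℂ, ‖g0‖ = Real.sqrt (Fintype.card F) ^ d ∧
      ∀ s : F, s ≠ 0 → ∑ z, ψ (s * Q z) = cyChi F s ^ d * g0 := by
  have h2 : (2 : F) ≠ 0 := Ring.two_ne_zero hF
  have : Invertible (2 : F) := invertibleOfNonzero h2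
  have hsep : (QuadraticMap.associated (R := F) Q).SeparatingLeft := by
    intro x hx
    apply hQ
    intro y
    have h := hx y
    have h3 := QuadraticMap.two_nsmul_associated F Q
    have h4 := congrArg (fun B => B x y) h3
    simp only [LinearMap.smul_apply, QuadraticMap.polarBilin_apply_apply] at h4
    rw [← h4, h, smul_zero]
  obtain ⟨w, ⟨e⟩⟩ := QuadraticForm.equivalent_weightedSumSquares_units_of_nondegenerate' Q hsep
  have hfr : Module.finrank F (Fin d → F) = d := by simp
  refine ⟨∏ i, (cyChi F (w i : F) * gaussSum (cyChi F) ψ), ?_, ?_⟩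
  · rw [norm_prod]
    have : ∀ i, ‖cyChi F (w i : F) * gaussSum (cyChi F) ψ‖ = Real.sqrt (Fintype.card F) := by
      intro i
      rw [norm_mul, cy_chi_norm _ (w i).ne_zero, one_mul, cy_gauss_norm hF ψ hψ]
    simp only [this, Finset.prod_const, Finset.card_univ, Fintype.card_fin]
    rw [hfr]
  · intro s hs
    have h1 : ∑ z, ψ (s * Q z) = ∑ v : Fin (Module.finrank F (Fin d → F)) → F,
        ∏ i, ψ (s * (w i : F) * v i ^ 2) := by
      refine Fintype.sum_equiv e.toEquiv _ _ ?_
      intro z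
      have := e.map_app z
      rw [← this, QuadraticMap.weightedSumSquares_apply, Finset.mul_sum, cy_char_sum]
      refine Finset.prod_congr rfl fun i _ => ?_
      congr 1
      simp only [Units.smul_def, smul_eq_mul]
      have : e.toEquiv z = e z := rfl
      rw [this]
      ring
    have h3 := Finset.sum_prod_piFinset (Finset.univ : Finset F)
      (fun (i : Fin (Module.finrank F (Fin d → F))) x => ψ (s * (w i : F) * x ^ 2))
    rw [Fintype.piFinset_univ] at h3
    rw [h1, h3]
    have h4 : ∀ i, ∑ x, ψ (s * (w i : F) * x ^ 2)
        = cyChi F s * (cyChi F (w i : F) * gaussSum (cyChi F) ψ) := by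
      intro i
      rw [cy_gauss_quad hF ψ hψ _ (mul_ne_zero hs (w i).ne_zero), map_mul, mul_assoc]
    simp only [h4]
    rw [Finset.prod_mul_distrib, Finset.prod_const, Finset.card_univ, Fintype.card_fin]
    have h5 : cyChi F s ^ Module.finrank F (Fin d → F) = cyChi F s ^ d := by rw [hfr]
    rw [h5]

/-- Plancherel type bound for convolution forms. -/
lemma cy_planch {V : Type*} [Fintype V] [AddCommGroup V] [DecidableEq V] (e : V → V → ℂ) (M L : ℝ)
    (hM : 0 < M)
    (he0 : ∀ w, e w 0 = 1)
    (hsub : ∀ w x y, e w (x - y) = e w x * starRingEnd ℂ (e w y))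
    (horth : ∀ u, ∑ w, e w u = if u = 0 then (M : ℂ) else 0)
    (R : V → ℂ) (hR : ∀ w, ‖∑ z, R z * e w z‖ ≤ L) (a : V → ℝ) :
    ‖∑ x, ∑ y, (a x : ℂ) * a y * R (x - y)‖ ≤ L * ∑ x, a x ^ 2 := by
  set f : V → ℂ := fun w => ∑ x, (a x : ℂ) * e w x with hf
  have hMc : (M : ℂ) ≠ 0 := by exact_mod_cast hM.ne'
  -- inversion
  have key : ∀ S : V → ℂ, (M : ℂ) * ∑ x, ∑ y, (a x : ℂ) * a y * S (x - y)
      = ∑ w, (∑ z, S z * e w z) * (starRingEnd ℂ (f w) * f w) := by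
    intro S
    have h1 : ∀ u, (M : ℂ) * S u = ∑ w, (∑ z, S z * e w z) * starRingEnd ℂ (e w u) := by
      intro u
      simp only [Finset.sum_mul]
      rw [Finset.sum_comm]
      have : ∀ z, ∑ w, S z * e w z * starRingEnd ℂ (e w u) = if z = u then (M : ℂ) * S u else 0 := by
        intro z
        simp only [mul_assoc, ← hsub]
        rw [← Finset.mul_sum, horth]
        by_cases h : z = u
        · simp [h, mul_comm]
        · simp [h, sub_eq_zero]
      simp [this]
    have h2 : ∀ w x y, starRingEnd ℂ (e w (x - y)) = starRingEnd ℂ (e w x) * e w y := by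
      intro w x y; rw [hsub, map_mul, Complex.conj_conj]
    have h3 : ∀ w, starRingEnd ℂ (f w) * f w
        = ∑ x, ∑ y, (a x : ℂ) * a y * starRingEnd ℂ (e w (x - y)) := by
      intro w
      simp only [hf, map_sum, map_mul, Complex.conj_ofReal, Finset.sum_mul_sum, h2]
      refine Finset.sum_congr rfl fun x _ => Finset.sum_congr rfl fun y _ => ?_
      ring
    have h4 : ∑ w, (∑ z, S z * e w z) * (starRingEnd ℂ (f w) * f w)
        = ∑ w, ∑ x, ∑ y, (a x : ℂ) * a y *
          ((∑ z, S z * e w z) * starRingEnd ℂ (e w (x - y))) := by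
      refine Finset.sum_congr rfl fun w _ => ?_
      rw [h3, Finset.mul_sum]
      refine Finset.sum_congr rfl fun x _ => ?_
      rw [Finset.mul_sum]
      refine Finset.sum_congr rfl fun y _ => ?_
      ring
    rw [h4, Finset.mul_sum]
    refine Eq.trans ?_ Finset.sum_comm
    refine Finset.sum_congr rfl fun x _ => ?_
    rw [Finset.mul_sum]
    refine Eq.trans ?_ Finset.sum_comm
    refine Finset.sum_congr rfl fun y _ => ?_
    rw [← Finset.mul_sum, ← h1]
    ring
  have hpar : M * ∑ x, a x ^ 2 = ∑ w, ‖f w‖ ^ 2 := by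
    have h1 := key (fun u => if u = 0 then 1 else 0)
    have h2 : ∀ w, starRingEnd ℂ (f w) * f w = ((‖f w‖ ^ 2 : ℝ) : ℂ) := by
      intro w
      rw [mul_comm, Complex.mul_conj, Complex.normSq_eq_norm_sq]
    simp only [h2] at h1
    simp only [sub_eq_zero, mul_ite, mul_one, mul_zero, ite_mul, one_mul, zero_mul,
      Finset.sum_ite_eq, Finset.sum_ite_eq', Finset.mem_univ, if_true, he0] at h1
    have h3 : ((M * ∑ x, a x ^ 2 : ℝ) : ℂ) = ((∑ w, ‖f w‖ ^ 2 : ℝ) : ℂ) := by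
      push_cast
      push_cast at h1
      rw [← h1]
      congr 1
      exact Finset.sum_congr rfl fun x _ => by ring
    exact_mod_cast h3
  have hk := congrArg norm (key R)
  rw [norm_mul, Complex.norm_real, Real.norm_of_nonneg hM.le] at hk
  have hb : M * ‖∑ x, ∑ y, (a x : ℂ) * a y * R (x - y)‖ ≤ M * (L * ∑ x, a x ^ 2) := by
    rw [hk]
    calc _ ≤ ∑ w, ‖(∑ z, R z * e w z) * (starRingEnd ℂ (f w) * f w)‖ := norm_sum_le _ _
      _ ≤ ∑ w, L * ‖f w‖ ^ 2 := by
          refine Finset.sum_le_sum fun w _ => ?_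
          rw [norm_mul, norm_mul, RCLike.norm_conj, ← sq]
          exact mul_le_mul_of_nonneg_right (hR w) (sq_nonneg _)
      _ = M * (L * ∑ x, a x ^ 2) := by
          rw [← Finset.mul_sum, ← hpar]; ring
  exact le_of_mul_le_mul_left hb hM

end FourierPart

section FormBound

open Classical in
lemma cy_tw_bound {F : Type} [Field F] [Fintype F] (hF : ringChar F ≠ 2)
    (ψ : AddChar F ℂ) (hψ : ψ ≠ 1) (d : ℕ) (t : F) (ht : t ≠ 0) (b : F) :
    ‖∑ s : F, if s = 0 then 0 else cyChi F s ^ d * ψ (-(s * t) - s⁻¹ * b)‖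
      ≤ 2 * Real.sqrt (Fintype.card F) := by
  have ht' : -t⁻¹ ≠ 0 := neg_ne_zero.mpr (inv_ne_zero ht)
  have hq1 : 1 ≤ Real.sqrt (Fintype.card F) := by
    rw [Real.one_le_sqrt]; exact_mod_cast Fintype.card_pos
  have hsub : ∑ s : F, (if s = 0 then 0 else cyChi F s ^ d * ψ (-(s * t) - s⁻¹ * b))
      = cyChi F (-t⁻¹) ^ d * ∑ x : F, if x = 0 then 0 else cyChi F x ^ d * ψ (x + (b * t) * x⁻¹) := by
    rw [Finset.mul_sum]
    symm
    refine Fintype.sum_equiv (Equiv.mulLeft₀ (-t⁻¹) ht') _ _ ?_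
    intro x
    by_cases hx : x = 0
    · simp [hx]
    · have : -t⁻¹ * x ≠ 0 := mul_ne_zero ht' hx
      simp only [Equiv.mulLeft₀_apply, hx, this, if_false, map_mul, mul_pow, mul_assoc]
      congr 3
      field_simp
      ring
  rw [hsub, norm_mul, norm_pow, cy_chi_norm _ ht', one_pow, one_mul]
  rcases Nat.even_or_odd d with ⟨m, hm⟩ | ⟨m, hm⟩
  · have h1 : ∑ x : F, (if x = 0 then 0 else cyChi F x ^ d * ψ (x + (b * t) * x⁻¹))
        = cyKl ψ (b * t) := by
      unfold cyKl
      refine Finset.sum_congr rfl fun x _ => ?_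
      by_cases hx : x = 0
      · simp [hx]
      · rw [if_neg hx, if_neg hx, hm, ← two_mul, pow_mul, cy_chi_sq x hx, one_pow, one_mul]
    rw [h1]
    by_cases hb : b = 0
    · have h0 : ∑ x : F, ψ x = 0 := by
        have := cy_prim ψ hψ 1 one_ne_zero
        simpa using this
      have h2 : cyKl ψ (b * t) = -1 := by
        unfold cyKl
        have : ∀ x : F, (if x = 0 then (0:ℂ) else ψ (x + b * t * x⁻¹))
            = ψ x - if x = 0 then 1 else 0 := by
          intro x
          by_cases hx : x = 0
          · simp [hx]
          · simp [hx, hb]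
        simp only [this, Finset.sum_sub_distrib, h0]
        simp
      rw [h2, norm_neg, norm_one]
      linarith
    · exact cy_weil hF ψ hψ _ (mul_ne_zero hb ht)
  · have h1 : ∑ x : F, (if x = 0 then 0 else cyChi F x ^ d * ψ (x + (b * t) * x⁻¹))
        = ∑ x, cyChi F x * ψ (x + (b * t) * x⁻¹) := by
      refine Finset.sum_congr rfl fun x _ => ?_
      by_cases hx : x = 0
      · simp [hx, cy_chi_zero]
      · rw [if_neg hx, hm, pow_succ, pow_mul, cy_chi_sq x hx, one_pow, one_mul]
    rw [h1]
    exact cy_salie hF ψ hψ _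

open Classical in
lemma cy_hat_bound {F : Type} [Field F] [Fintype F] (hF : ringChar F ≠ 2)
    (ψ : AddChar F ℂ) (hψ : ψ ≠ 1) {d : ℕ} (Q : QuadraticForm F (Fin d → F))
    (hQ : ∀ x, (∀ y, QuadraticMap.polar (⇑Q) x y = 0) → x = 0) (t : F) (ht : t ≠ 0)
    (w : Fin d → F) :
    ‖∑ z, ((if Q z = t then (1 : ℂ) else 0) - 1 / (Fintype.card F : ℂ))
        * ψ (QuadraticMap.polar (⇑Q) w z)‖
      ≤ 2 * Real.sqrt (Fintype.card F) ^ (d + 1) / Fintype.card F := by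
  obtain ⟨g0, hg0, hG⟩ := cy_form_gauss hF ψ hψ Q hQ
  have hq0 : (Fintype.card F : ℂ) ≠ 0 := by exact_mod_cast Fintype.card_ne_zero
  have hR : ∀ z, ((if Q z = t then (1 : ℂ) else 0) - 1 / (Fintype.card F : ℂ))
      = 1 / (Fintype.card F : ℂ) * ∑ s : F, if s = 0 then 0 else ψ (s * (Q z - t)) := by
    intro z
    have h1 : ∑ s : F, (if s = 0 then 0 else ψ (s * (Q z - t)))
        = (∑ s : F, ψ (s * (Q z - t))) - 1 := by
      have : ∀ s : F, (if s = 0 then (0:ℂ) else ψ (s * (Q z - t)))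
            = ψ (s * (Q z - t)) - if s = 0 then 1 else 0 := by
        intro s
        by_cases hs : s = 0
        · simp [hs]
        · simp [hs]
      simp only [this, Finset.sum_sub_distrib]
      simp
    rw [h1]
    by_cases h : Q z = t
    · simp [h]; field_simp
    · rw [cy_prim ψ hψ _ (sub_ne_zero.mpr h), if_neg h]; ring
  have hS : ∑ z, ((if Q z = t then (1 : ℂ) else 0) - 1 / (Fintype.card F : ℂ))
        * ψ (QuadraticMap.polar (⇑Q) w z)
      = 1 / (Fintype.card F : ℂ) * g0 *
        ∑ s : F, if s = 0 then 0 else cyChi F s ^ d * ψ (-(s * t) - s⁻¹ * Q w) := by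
    simp only [hR]
    have h1 : ∀ s : F, ∑ z, (if s = 0 then 0 else ψ (s * (Q z - t))) *
        ψ (QuadraticMap.polar (⇑Q) w z)
        = g0 * if s = 0 then 0 else cyChi F s ^ d * ψ (-(s * t) - s⁻¹ * Q w) := by
      intro s
      by_cases hs : s = 0
      · simp [hs]
      simp only [if_neg hs]
      have h2 : ∀ z, ψ (s * (Q z - t)) * ψ (QuadraticMap.polar (⇑Q) w z)
          = ψ (-(s * t) - s⁻¹ * Q w) * ψ (s * Q (z + s⁻¹ • w)) := by
        intro z
        rw [← AddChar.map_add_eq_mul, ← AddChar.map_add_eq_mul]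
        congr 1
        have h3 := QuadraticMap.map_add (⇑Q) z (s⁻¹ • w)
        rw [QuadraticMap.polar_smul_right, QuadraticMap.map_smul, QuadraticMap.polar_comm] at h3
        rw [h3]
        simp only [smul_eq_mul]
        field_simp
        ring
      simp only [h2]
      rw [← Finset.mul_sum]
      have h4 : ∑ z, ψ (s * Q (z + s⁻¹ • w)) = ∑ z, ψ (s * Q z) :=
        Fintype.sum_equiv (Equiv.addRight (s⁻¹ • w)) _ _ (fun z => rfl)
      rw [h4, hG s hs]
      ring
    rw [mul_assoc, Finset.mul_sum (a := g0), ← Finset.sum_congr rfl fun s _ => h1 s,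
      Finset.sum_comm, Finset.mul_sum]
    refine Finset.sum_congr rfl fun z _ => ?_
    rw [mul_assoc, Finset.sum_mul]
  rw [hS, norm_mul, norm_mul, hg0]
  have h5 := cy_tw_bound hF ψ hψ d t ht (Q w)
  have h6 : ‖(1 / (Fintype.card F : ℂ))‖ = 1 / (Fintype.card F : ℝ) := by
    rw [norm_div, norm_one, Complex.norm_natCast]
  rw [h6]
  calc _ ≤ 1 / (Fintype.card F : ℝ) * Real.sqrt (Fintype.card F) ^ d
        * (2 * Real.sqrt (Fintype.card F)) := by
        refine mul_le_mul_of_nonneg_left h5 (by positivity)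
    _ = _ := by rw [pow_succ]; ring

open Classical in
lemma cy_form_bound {F : Type} [Field F] [Fintype F] (hF : ringChar F ≠ 2)
    {d : ℕ} (Q : QuadraticForm F (Fin d → F))
    (hQ : ∀ x, (∀ y, QuadraticMap.polar (⇑Q) x y = 0) → x = 0) (t : F) (ht : t ≠ 0)
    (a : (Fin d → F) → ℝ) :
    |∑ x, ∑ y, a x * a y * (if Q (x - y) = t then 1 else 0) - (∑ x, a x) ^ 2 / Fintype.card F|
      ≤ 2 * Real.sqrt (Fintype.card F) ^ (d + 1) / Fintype.card F * ∑ x, a x ^ 2 := by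
  obtain ⟨ψ, hψ⟩ : ∃ ψ : AddChar F ℂ, ψ ≠ 1 := by
    obtain ⟨ψ, hψ⟩ := (AddChar.exists_apply_ne_zero (α := F)).mpr (one_ne_zero)
    exact ⟨ψ, by rintro rfl; simp at hψ⟩
  have h := cy_planch (V := Fin d → F) (fun w z => ψ (QuadraticMap.polar (⇑Q) w z))
    ((Fintype.card F : ℝ) ^ d) (2 * Real.sqrt (Fintype.card F) ^ (d + 1) / Fintype.card F)
    (by have : 0 < Fintype.card F := Fintype.card_pos
        positivity)
    (by intro w; simp)
    (by
      intro w x y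
      simp only [sub_eq_add_neg, QuadraticMap.polar_add_right, QuadraticMap.polar_neg_right,
        AddChar.map_add_eq_mul, AddChar.map_neg_eq_conj])
    (by
      intro u
      by_cases hu : u = 0
      · simp [hu]
      rw [if_neg hu]
      have : ∃ y, QuadraticMap.polar (⇑Q) u y ≠ 0 := by
        by_contra hcon
        push Not at hcon
        exact hu (hQ u hcon)
      obtain ⟨y, hy⟩ := this
      obtain ⟨c, hc⟩ : ∃ c : F, ψ c ≠ 1 := by
        by_contra hcon
        push Not at hcon
        exact hψ (by ext c; simp [hcon])
      set v := (c / QuadraticMap.polar (⇑Q) u y) • y with hv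
      have hpv : QuadraticMap.polar (⇑Q) v u = c := by
        rw [hv, QuadraticMap.polar_smul_left, QuadraticMap.polar_comm (⇑Q) y u, smul_eq_mul,
          div_mul_cancel₀ _ hy]
      have h1 : ∑ w, ψ (QuadraticMap.polar (⇑Q) w u)
          = ∑ w, ψ c * ψ (QuadraticMap.polar (⇑Q) w u) := by
        symm
        refine Fintype.sum_equiv (Equiv.addRight v) _ _ ?_
        intro w
        simp only [Equiv.coe_addRight]
        rw [QuadraticMap.polar_add_left, hpv, AddChar.map_add_eq_mul, mul_comm]
      rw [← Finset.mul_sum] at h1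
      have h2 : (1 - ψ c) * ∑ w, ψ (QuadraticMap.polar (⇑Q) w u) = 0 := by
        linear_combination h1
      rcases mul_eq_zero.mp h2 with h3 | h3
      · exact absurd (by linear_combination -h3) hc
      · exact h3)
    (fun z => (if Q z = t then (1 : ℂ) else 0) - 1 / (Fintype.card F : ℂ))
    (cy_hat_bound hF ψ hψ Q hQ t ht) a
  refine le_trans (le_of_eq ?_) h
  rw [← Real.norm_eq_abs, ← Complex.norm_real]
  congr 1
  push_cast
  simp only [mul_sub, Finset.sum_sub_distrib]
  congr 1
  · refine Finset.sum_congr rfl fun x _ => Finset.sum_congr rfl fun y _ => ?_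
    split_ifs <;> simp
  · rw [sq, Finset.sum_mul_sum, Finset.sum_div]
    refine Finset.sum_congr rfl fun x _ => ?_
    rw [Finset.sum_div]
    refine Finset.sum_congr rfl fun y _ => ?_
    ring

end FormBound

section SpecPart

lemma cy_diag {X : Type*} [Fintype X] [DecidableEq X] (A : Matrix X X ℝ) (hA : A.transpose = A) :
    ∃ (μ : X → ℝ) (u : X → X → ℝ),
      (∀ a z w, (A ^ a) z w = ∑ i, μ i ^ a * (u i z * u i w)) ∧
      (∀ i j, ∑ z, u i z * u j z = if i = j then 1 else 0) ∧
      (∀ z w, ∑ i, u i z * u i w = if z = w then 1 else 0) := by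
  have hH : A.IsHermitian := by
    rw [Matrix.IsHermitian, Matrix.conjTranspose_eq_transpose_of_trivial, hA]
  set U : Matrix X X ℝ := (hH.eigenvectorUnitary : Matrix X X ℝ) with hU
  have h1 : U * U.transpose = 1 := by
    have := Unitary.coe_mul_star_self hH.eigenvectorUnitary
    simpa [hU, Matrix.star_eq_conjTranspose, Matrix.conjTranspose_eq_transpose_of_trivial] using this
  have h2 : U.transpose * U = 1 := by
    have := Unitary.coe_star_mul_self hH.eigenvectorUnitary
    simpa [hU, Matrix.star_eq_conjTranspose, Matrix.conjTranspose_eq_transpose_of_trivial] using this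
  have h3 : A = U * Matrix.diagonal hH.eigenvalues * U.transpose := by
    have := hH.spectral_theorem
    simp only [Unitary.conjStarAlgAut_apply] at this
    simpa [hU, Matrix.star_eq_conjTranspose, Matrix.conjTranspose_eq_transpose_of_trivial] using this
  have h4 : ∀ a, A ^ a = U * Matrix.diagonal (fun i => hH.eigenvalues i ^ a) * U.transpose := by
    intro a
    induction a with
    | zero => simp [h1]
    | succ a ih =>
      rw [pow_succ, ih]
      nth_rewrite 2 [h3]
      calc _ = U * Matrix.diagonal (fun i => hH.eigenvalues i ^ a) * (U.transpose * U)
            * Matrix.diagonal hH.eigenvalues * U.transpose := by simp only [Matrix.mul_assoc]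
        _ = _ := by
          rw [h2, Matrix.mul_one, Matrix.mul_assoc U, Matrix.diagonal_mul_diagonal]
          simp only [pow_succ]
  refine ⟨hH.eigenvalues, fun i z => U z i, ?_, ?_, ?_⟩
  · intro a z w
    rw [h4, Matrix.mul_apply]
    refine Finset.sum_congr rfl fun i _ => ?_
    rw [Matrix.mul_diagonal, Matrix.transpose_apply]
    ring
  · intro i j
    have := congrFun (congrFun h2 i) j
    rw [Matrix.mul_apply, Matrix.one_apply] at this
    simpa [Matrix.transpose_apply] using this
  · intro z w
    have := congrFun (congrFun h1 z) w
    rw [Matrix.mul_apply, Matrix.one_apply] at this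
    simpa [Matrix.transpose_apply] using this

lemma cy_spec {X : Type*} [Fintype X] [DecidableEq X] [Nonempty X] (A : Matrix X X ℝ)
    (p L : ℝ) (hp : 0 ≤ p)
    (hform : ∀ a : X → ℝ, |∑ x, ∑ y, a x * a y * A x y - (∑ x, a x) ^ 2 * p| ≤ L * ∑ x, a x ^ 2)
    (μ : X → ℝ) (u : X → X → ℝ)
    (h1 : ∀ a z w, (A ^ a) z w = ∑ i, μ i ^ a * (u i z * u i w))
    (h2 : ∀ i j, ∑ z, u i z * u j z = if i = j then 1 else 0)
    (h3 : ∀ z w, ∑ i, u i z * u i w = if z = w then 1 else 0) :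
    ∃ i0, |μ i0 - Fintype.card X * p| ≤ L ∧ ∀ i, i ≠ i0 → |μ i| ≤ L := by
  have hA : ∀ z w, A z w = ∑ i, μ i * (u i z * u i w) := by
    intro z w; have := h1 1 z w; simpa using this
  set s : X → ℝ := fun i => ∑ z, u i z with hs
  -- general quadratic form
  have hq : ∀ a : X → ℝ, ∑ x, ∑ y, a x * a y * A x y = ∑ i, μ i * (∑ x, a x * u i x) ^ 2 := by
    intro a
    have : ∀ i, μ i * (∑ x, a x * u i x) ^ 2
        = ∑ x, ∑ y, a x * a y * (μ i * (u i x * u i y)) := by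
      intro i
      rw [sq, Finset.sum_mul_sum, Finset.mul_sum]
      refine Finset.sum_congr rfl fun x _ => ?_
      rw [Finset.mul_sum]
      refine Finset.sum_congr rfl fun y _ => ?_
      ring
    simp only [this]
    refine Eq.trans ?_ Finset.sum_comm
    refine Finset.sum_congr rfl fun x _ => ?_
    refine Eq.trans ?_ Finset.sum_comm
    refine Finset.sum_congr rfl fun y _ => ?_
    rw [hA, Finset.mul_sum]
  -- on combinations of two eigenvectors
  have hcomb : ∀ i j, i ≠ j → ∀ α β : ℝ, |α ^ 2 * μ i + β ^ 2 * μ j - (α * s i + β * s j) ^ 2 * p|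
      ≤ L * (α ^ 2 + β ^ 2) := by
    intro i j hij α β
    have h := hform (fun x => α * u i x + β * u j x)
    have e1 : ∀ k, ∑ x, (α * u i x + β * u j x) * u k x
        = α * (if i = k then 1 else 0) + β * (if j = k then 1 else 0) := by
      intro k
      rw [← h2, ← h2, Finset.mul_sum, Finset.mul_sum, ← Finset.sum_add_distrib]
      exact Finset.sum_congr rfl fun x _ => by ring
    have e2 : ∑ x, (α * u i x + β * u j x) ^ 2 = α ^ 2 + β ^ 2 := by
      have : ∀ x, (α * u i x + β * u j x) ^ 2 = α * ((α * u i x + β * u j x) * u i x)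
          + β * ((α * u i x + β * u j x) * u j x) := fun x => by ring
      simp only [this, Finset.sum_add_distrib, ← Finset.mul_sum, e1]
      simp [hij, hij.symm]; ring
    have e3 : ∑ x, (α * u i x + β * u j x) = α * s i + β * s j := by
      simp only [hs, Finset.sum_add_distrib, ← Finset.mul_sum]
    rw [hq, e2, e3] at h
    simp only [e1] at h
    have e4 : ∑ k, μ k * (α * (if i = k then 1 else 0) + β * (if j = k then 1 else 0)) ^ 2
        = α ^ 2 * μ i + β ^ 2 * μ j := by
      have : ∀ k, μ k * (α * (if i = k then 1 else 0) + β * (if j = k then 1 else 0)) ^ 2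
          = (if i = k then α ^ 2 * μ k else 0) + (if j = k then β ^ 2 * μ k else 0) := by
        intro k
        by_cases hi : i = k
        · have hj : j ≠ k := by rintro rfl; exact hij hi
          simp [hi, hj]; ring
        · by_cases hj : j = k
          · simp [hi, hj]; ring
          · simp [hi, hj]
      simp only [this, Finset.sum_add_distrib]
      simp
    rw [e4] at h
    exact h
  have hsingle : ∀ i, |μ i - s i ^ 2 * p| ≤ L := by
    intro i
    have h := hform (fun x => u i x)
    rw [hq] at h
    simp only [h2] at h
    have e2 : ∑ x, u i x ^ 2 = 1 := by
      have := h2 i i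
      simp only [← sq] at this
      simpa using this
    rw [e2] at h
    simpa using h
  have hone : ∑ i, s i ^ 2 = Fintype.card X := by
    have : ∀ i, s i ^ 2 = ∑ x, ∑ y, u i x * u i y := by
      intro i; rw [sq, hs, Finset.sum_mul_sum]
    simp only [this]
    rw [Finset.sum_comm]
    rw [Finset.sum_congr rfl fun x _ => Finset.sum_comm]
    simp [h3]
  have hsle : ∀ i, s i ^ 2 ≤ Fintype.card X := by
    intro i
    rw [← hone]
    exact Finset.single_le_sum (f := fun i => s i ^ 2) (fun i _ => sq_nonneg _) (Finset.mem_univ i)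
  obtain ⟨i0, hi0⟩ := Finite.exists_max μ
  have hcard : (0 : ℝ) < Fintype.card X := by exact_mod_cast Fintype.card_pos
  refine ⟨i0, ?_, ?_⟩
  · rw [abs_le]
    constructor
    · have h := hform (fun _ => 1)
      rw [hq] at h
      simp only [one_mul, one_pow, Finset.sum_const, Finset.card_univ, nsmul_eq_mul, mul_one] at h
      have h5 : ∑ i, μ i * s i ^ 2 ≤ μ i0 * Fintype.card X := by
        rw [← hone, Finset.mul_sum]
        exact Finset.sum_le_sum fun i _ => mul_le_mul_of_nonneg_right (hi0 i) (sq_nonneg _)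
      have h6 := (abs_le.mp h).1
      have h7 : ∑ i, μ i * (∑ x, u i x) ^ 2 ≤ μ i0 * Fintype.card X := h5
      have h8 : (Fintype.card X : ℝ) * (-L) ≤ Fintype.card X * (μ i0 - Fintype.card X * p) := by
        nlinarith
      exact le_of_mul_le_mul_left h8 hcard
    · have h := (abs_le.mp (hsingle i0)).2
      have := mul_le_mul_of_nonneg_right (hsle i0) hp
      linarith
  · intro i hi
    rw [abs_le]
    constructor
    · have h := (abs_le.mp (hsingle i)).1
      have : 0 ≤ s i ^ 2 * p := by positivity
      linarith
    · by_contra hcon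
      push Not at hcon
      have hcon0 : L < μ i0 := lt_of_lt_of_le hcon (hi0 i)
      by_cases hz : s i = 0
      · have h := hcomb i i0 hi 1 0
        simp [hz] at h
        have := (abs_le.mp h).2
        linarith
      · have h := hcomb i i0 hi (s i0) (-s i)
        have e : s i0 * s i + -s i * s i0 = 0 := by ring
        rw [e] at h
        have h' := (abs_le.mp h).2
        have hpos : 0 < s i ^ 2 := by positivity
        have := sq_nonneg (s i0)
        nlinarith

end SpecPart

section GraphPart

lemma cy_pow_diff (m X L : ℝ) (hX : 0 ≤ X) (hL : 0 ≤ L) (h : |m - X| ≤ L) (n : ℕ) :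
    |m ^ n - X ^ n| ≤ (X + L) ^ n - X ^ n := by
  induction n with
  | zero => simp
  | succ n ih =>
    have hm : |m| ≤ X + L := by
      rw [abs_le] at h ⊢
      constructor <;> linarith [h.1, h.2]
    have e : m ^ (n + 1) - X ^ (n + 1) = m * (m ^ n - X ^ n) + (m - X) * X ^ n := by ring
    rw [e]
    calc _ ≤ |m * (m ^ n - X ^ n)| + |(m - X) * X ^ n| := abs_add_le _ _
      _ = |m| * |m ^ n - X ^ n| + |m - X| * X ^ n := by
          rw [abs_mul, abs_mul, abs_of_nonneg (pow_nonneg hX n)]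
      _ ≤ (X + L) * ((X + L) ^ n - X ^ n) + L * X ^ n := by
          refine add_le_add (mul_le_mul hm ih (abs_nonneg _) (by positivity)) ?_
          exact mul_le_mul_of_nonneg_right h (pow_nonneg hX n)
      _ = _ := by ring

lemma cy_graph {X : Type*} [Fintype X] [DecidableEq X] [Nonempty X] (A : Matrix X X ℝ)
    (hA : A.transpose = A) (hA01 : ∀ x y, A x y = 0 ∨ A x y = 1)
    (p L D : ℝ) (hp : 0 ≤ p) (hL : 0 ≤ L)
    (hform : ∀ a : X → ℝ, |∑ x, ∑ y, a x * a y * A x y - (∑ x, a x) ^ 2 * p| ≤ L * ∑ x, a x ^ 2)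
    (hD : ∀ z, ∑ w, A z w ≤ D) (N X0 ρ : ℝ) (hN : N = Fintype.card X) (hX0 : X0 = N * p)
    (hρ : ρ = X0 + L) :
    (∀ n, |Matrix.trace (A ^ (n + 2)) - X0 ^ (n + 2)|
      ≤ (ρ ^ (n + 2) - X0 ^ (n + 2)) + L ^ n * (N * ρ)) ∧
    (∀ a b, ∑ z, (A ^ (a + 2)) z z * (A ^ (b + 2)) z z ≤ ρ ^ (a + b + 2) * N) ∧
    (∀ m, ∑ z, (A ^ 2) z z * (A ^ (m + 2)) z z ≤ D * (ρ ^ (m + 2) + L ^ m * (N * ρ))) ∧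
    (∑ z, (A ^ 3) z z * (A ^ 3) z z ≤ D * (ρ ^ 4 + L ^ 2 * (N * ρ))) := by
  obtain ⟨μ, u, h1, h2, h3⟩ := cy_diag A hA
  obtain ⟨i0, hi0, hi⟩ := cy_spec A p L hp hform μ u h1 h2 h3
  rw [← hN, ← hX0] at hi0
  have hN0 : 0 ≤ N := by rw [hN]; positivity
  have hX00 : 0 ≤ X0 := by rw [hX0]; positivity
  have hρ0 : 0 ≤ ρ := by rw [hρ]; positivity
  have hμ : ∀ i, |μ i| ≤ ρ := by
    intro i
    by_cases h : i = i0
    · rw [h, hρ]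
      rw [abs_le] at hi0 ⊢
      constructor <;> linarith [hi0.1, hi0.2]
    · exact (hi i h).trans (by rw [hρ]; linarith)
  have hA0 : ∀ x y, 0 ≤ A x y := by
    intro x y; rcases hA01 x y with h | h <;> rw [h] <;> norm_num
  have hApos : ∀ a x y, 0 ≤ (A ^ a) x y := by
    intro a
    induction a with
    | zero => intro x y; rw [pow_zero, Matrix.one_apply]; split_ifs <;> norm_num
    | succ a ih =>
      intro x y
      rw [pow_succ, Matrix.mul_apply]
      exact Finset.sum_nonneg fun z _ => mul_nonneg (ih x z) (hA0 z y)
  have hsymm : ∀ x y, A x y = A y x := fun x y => by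
    conv_lhs => rw [← hA]
    rfl
  have hdeg : ∀ z, (A ^ 2) z z = ∑ w, A z w := by
    intro z
    rw [sq, Matrix.mul_apply]
    refine Finset.sum_congr rfl fun w _ => ?_
    rw [hsymm w z]
    rcases hA01 z w with h | h <;> rw [h] <;> norm_num
  have hu1 : ∀ i, ∑ z, u i z * u i z = 1 := fun i => by rw [h2]; simp
  have htr : ∀ a, Matrix.trace (A ^ a) = ∑ i, μ i ^ a := by
    intro a
    simp only [Matrix.trace, Matrix.diag_apply, h1]
    rw [Finset.sum_comm]
    refine Finset.sum_congr rfl fun i _ => ?_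
    rw [← Finset.mul_sum, hu1, mul_one]
  have htr2 : ∑ i, μ i ^ 2 ≤ N * ρ := by
    rw [← htr]
    simp only [Matrix.trace, Matrix.diag_apply, hdeg]
    have h := (abs_le.mp (hform (fun _ => 1))).2
    simp only [one_mul, one_pow, Finset.sum_const, Finset.card_univ, nsmul_eq_mul, mul_one,
      ← hN] at h
    rw [hρ, hX0]
    nlinarith
  have hother : ∀ m, ∑ i ∈ Finset.univ.erase i0, |μ i| ^ (m + 2) ≤ L ^ m * (N * ρ) := by
    intro m
    calc _ ≤ ∑ i ∈ Finset.univ.erase i0, L ^ m * μ i ^ 2 := by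
          refine Finset.sum_le_sum fun i hi' => ?_
          rw [pow_add, sq_abs]
          refine mul_le_mul_of_nonneg_right ?_ (sq_nonneg _)
          exact pow_le_pow_left₀ (abs_nonneg _) (hi i (Finset.ne_of_mem_erase hi')) m
      _ = L ^ m * ∑ i ∈ Finset.univ.erase i0, μ i ^ 2 := by rw [Finset.mul_sum]
      _ ≤ L ^ m * (N * ρ) := by
          refine mul_le_mul_of_nonneg_left (le_trans ?_ htr2) (pow_nonneg hL m)
          exact Finset.sum_le_sum_of_subset_of_nonneg (Finset.erase_subset _ _)
            fun i _ _ => sq_nonneg _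
  have hsplit : ∀ f : X → ℝ, ∑ i, f i = f i0 + ∑ i ∈ Finset.univ.erase i0, f i := by
    intro f; rw [Finset.add_sum_erase _ _ (Finset.mem_univ i0)]
  have htrbd : ∀ m, Matrix.trace (A ^ (m + 2)) ≤ ρ ^ (m + 2) + L ^ m * (N * ρ) := by
    intro m
    rw [htr, hsplit]
    refine add_le_add ?_ ?_
    · exact (le_abs_self _).trans (by rw [abs_pow]; exact pow_le_pow_left₀ (abs_nonneg _) (hμ i0) _)
    · refine le_trans (Finset.sum_le_sum fun i _ => ?_) (hother m)
      exact (le_abs_self _).trans (by rw [abs_pow])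
  have hdiag : ∀ a z, (A ^ (a + 2)) z z ≤ ρ ^ a * (A ^ 2) z z := by
    intro a z
    rw [h1, h1, Finset.mul_sum]
    refine Finset.sum_le_sum fun i _ => ?_
    have e : μ i ^ (a + 2) * (u i z * u i z) = μ i ^ a * (μ i ^ 2 * (u i z * u i z)) := by ring
    rw [e]
    refine mul_le_mul_of_nonneg_right ?_ (mul_nonneg (sq_nonneg _) (mul_self_nonneg _))
    exact (le_abs_self _).trans (by rw [abs_pow]; exact pow_le_pow_left₀ (abs_nonneg _) (hμ i) _)
  have hdeg2 : ∑ z, (A ^ 2) z z * (A ^ 2) z z ≤ ρ ^ 2 * N := by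
    have e1 : ∑ z, (A ^ 2) z z * (A ^ 2) z z = ∑ x, ∑ y, (A ^ 2) x y := by
      simp only [hdeg]
      have : ∀ z, (∑ w, A z w) * (∑ w, A z w) = ∑ x, ∑ y, A x z * A z y := by
        intro z
        rw [Finset.sum_mul_sum]
        simp only [hsymm z]
      simp only [this]
      rw [Finset.sum_comm]
      refine Finset.sum_congr rfl fun x _ => ?_
      rw [Finset.sum_comm]
      refine Finset.sum_congr rfl fun y _ => ?_
      rw [sq, Matrix.mul_apply]
    have e2 : ∀ i, ∑ x, ∑ y, u i x * u i y = (∑ x, u i x) ^ 2 := by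
      intro i; rw [sq, Finset.sum_mul_sum]
    have e3 : ∑ x, ∑ y, (A ^ 2) x y = ∑ i, μ i ^ 2 * (∑ x, u i x) ^ 2 := by
      simp only [h1, ← e2, Finset.mul_sum]
      refine Eq.trans ?_ Finset.sum_comm
      refine Finset.sum_congr rfl fun x _ => ?_
      refine Eq.trans ?_ Finset.sum_comm
      rfl
    have e4 : ∑ i, (∑ x, u i x) ^ 2 = N := by
      simp only [← e2]
      rw [Finset.sum_comm]
      rw [Finset.sum_congr rfl fun x _ => Finset.sum_comm]
      simp [h3, hN]
    rw [e1, e3, ← e4, Finset.mul_sum]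
    refine Finset.sum_le_sum fun i _ => mul_le_mul_of_nonneg_right ?_ (sq_nonneg _)
    rw [← sq_abs]
    exact pow_le_pow_left₀ (abs_nonneg _) (hμ i) 2
  refine ⟨?_, ?_, ?_, ?_⟩
  · intro n
    rw [htr, hsplit]
    have e : ∀ s : ℝ, μ i0 ^ (n + 2) + s - X0 ^ (n + 2) = (μ i0 ^ (n + 2) - X0 ^ (n + 2)) + s :=
      fun s => by ring
    rw [e]
    refine (abs_add_le _ _).trans (add_le_add ?_ ?_)
    · rw [hρ]; exact cy_pow_diff _ _ _ hX00 hL hi0 _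
    · refine (Finset.abs_sum_le_sum_abs _ _).trans ?_
      simp only [abs_pow]
      exact hother n
  · intro a b
    calc _ ≤ ∑ z, ρ ^ (a + b) * ((A ^ 2) z z * (A ^ 2) z z) := by
          refine Finset.sum_le_sum fun z _ => ?_
          calc _ ≤ (ρ ^ a * (A ^ 2) z z) * (ρ ^ b * (A ^ 2) z z) :=
                mul_le_mul (hdiag a z) (hdiag b z) (hApos _ _ _)
                  (mul_nonneg (pow_nonneg hρ0 _) (hApos _ _ _))
            _ = _ := by ring
      _ = ρ ^ (a + b) * ∑ z, (A ^ 2) z z * (A ^ 2) z z := by rw [Finset.mul_sum]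
      _ ≤ ρ ^ (a + b) * (ρ ^ 2 * N) := mul_le_mul_of_nonneg_left hdeg2 (pow_nonneg hρ0 _)
      _ = _ := by ring
  · intro m
    calc _ ≤ ∑ z, D * (A ^ (m + 2)) z z := by
          refine Finset.sum_le_sum fun z _ => mul_le_mul_of_nonneg_right ?_ (hApos _ _ _)
          rw [hdeg]; exact hD z
      _ = D * Matrix.trace (A ^ (m + 2)) := by
          rw [← Finset.mul_sum]; rfl
      _ ≤ _ := by
          refine mul_le_mul_of_nonneg_left (htrbd m) ?_
          obtain ⟨z⟩ := (inferInstance : Nonempty X)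
          exact le_trans (Finset.sum_nonneg fun w _ => hA0 z w) (hD z)
  · have hD0 : 0 ≤ D := by
      obtain ⟨z⟩ := (inferInstance : Nonempty X)
      exact le_trans (Finset.sum_nonneg fun w _ => hA0 z w) (hD z)
    have hcs : ∀ z, (A ^ 3) z z * (A ^ 3) z z ≤ (A ^ 2) z z * (A ^ 4) z z := by
      intro z
      have := Finset.sum_mul_sq_le_sq_mul_sq Finset.univ (fun i => μ i * u i z)
        (fun i => μ i ^ 2 * u i z)
      rw [h1, h1, h1]
      have e1 : ∀ i, μ i ^ 3 * (u i z * u i z) = (μ i * u i z) * (μ i ^ 2 * u i z) := fun i => by ring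
      have e2 : ∀ i, μ i ^ 2 * (u i z * u i z) = (μ i * u i z) ^ 2 := fun i => by ring
      have e3 : ∀ i, μ i ^ 4 * (u i z * u i z) = (μ i ^ 2 * u i z) ^ 2 := fun i => by ring
      simp only [e1, e2, e3]
      rw [← sq]
      exact this
    calc _ ≤ ∑ z, D * (A ^ 4) z z := by
          refine Finset.sum_le_sum fun z _ => (hcs z).trans ?_
          refine mul_le_mul_of_nonneg_right ?_ (hApos _ _ _)
          rw [hdeg]; exact hD z
      _ = D * Matrix.trace (A ^ 4) := by
          rw [← Finset.mul_sum]; rfl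
      _ ≤ _ := mul_le_mul_of_nonneg_left (htrbd 2) hD0

end GraphPart

section WalkPart

/-- Partial products of a sequence of matrices. -/
def cyP {X : Type*} [Fintype X] [DecidableEq X] (M : ℕ → Matrix X X ℝ) : ℕ → Matrix X X ℝ
  | 0 => 1
  | k + 1 => cyP M k * M k

lemma cy_open_walk {X : Type*} [Fintype X] [DecidableEq X] (M : ℕ → Matrix X X ℝ) (k : ℕ)
    (g : X → X → ℝ) :
    ∑ x : Fin (k + 1) → X, (∏ i : Fin k, M i (x i.castSucc) (x i.succ)) * g (x 0) (x (Fin.last k))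
      = ∑ u, ∑ v, cyP M k u v * g u v := by
  induction k generalizing g with
  | zero =>
    simp only [Finset.univ_eq_empty, Finset.prod_empty, one_mul, cyP, Matrix.one_apply, ite_mul,
      zero_mul, Finset.sum_ite_eq, Finset.mem_univ, if_true]
    refine Fintype.sum_equiv (Equiv.funUnique (Fin 1) X) _ _ ?_
    intro x
    rfl
  | succ k ih =>
    rw [← (Fin.snocEquiv (fun _ : Fin (k + 2) => X)).sum_comp, Fintype.sum_prod_type,
      Finset.sum_comm]
    have h1 : ∀ (x : Fin (k + 1) → X) (y : X),
        (∏ i : Fin (k + 1), M i ((Fin.snocEquiv (fun _ : Fin (k + 2) => X)) (y, x) i.castSucc)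
            ((Fin.snocEquiv (fun _ : Fin (k + 2) => X)) (y, x) i.succ)) *
          g ((Fin.snocEquiv (fun _ : Fin (k + 2) => X)) (y, x) 0)
            ((Fin.snocEquiv (fun _ : Fin (k + 2) => X)) (y, x) (Fin.last (k + 1)))
        = (∏ i : Fin k, M i (x i.castSucc) (x i.succ)) *
            (M k (x (Fin.last k)) y * g (x 0) y) := by
      intro x y
      rw [Fin.prod_univ_castSucc]
      simp only [Fin.snocEquiv_apply]
      have e0 : (Fin.snoc x y : Fin (k + 2) → X) 0 = x 0 := by
        have : (0 : Fin (k + 2)) = Fin.castSucc 0 := rfl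
        rw [this, Fin.snoc_castSucc (α := fun _ => X)]
      have e1 : ∀ i : Fin k, (Fin.snoc x y : Fin (k + 2) → X) i.castSucc.succ = x i.succ := by
        intro i
        rw [Fin.succ_castSucc, Fin.snoc_castSucc (α := fun _ => X)]
      have e2 : (Fin.snoc x y : Fin (k + 2) → X) (Fin.last k).succ = y := by
        rw [Fin.succ_last, Fin.snoc_last (α := fun _ => X)]
      have e3 : ∀ i : Fin (k + 1), (Fin.snoc x y : Fin (k + 2) → X) i.castSucc = x i := by
        intro i
        rw [Fin.snoc_castSucc (α := fun _ => X)]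
      have e4 : (Fin.snoc x y : Fin (k + 2) → X) (Fin.last (k + 1)) = y := by
        rw [Fin.snoc_last (α := fun _ => X)]
      simp only [e0, e1, e2, e3, e4, Fin.val_castSucc, Fin.val_last]
      ring
    simp only [h1, ← Finset.mul_sum]
    rw [ih (fun u v => ∑ y, M k v y * g u y)]
    refine Finset.sum_congr rfl fun u _ => ?_
    simp only [cyP, Matrix.mul_apply, Finset.sum_mul, Finset.mul_sum]
    rw [Finset.sum_comm]
    refine Finset.sum_congr rfl fun y _ => Finset.sum_congr rfl fun v _ => ?_
    ring

lemma cy_closed_walk {X : Type*} [Fintype X] [DecidableEq X] (M : ℕ → Matrix X X ℝ) (m : ℕ) :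
    ∑ x : Fin (m + 1) → X, ∏ i : Fin (m + 1), M i (x i) (x (finRotate (m + 1) i))
      = Matrix.trace (cyP M (m + 1)) := by
  have h1 : ∀ x : Fin (m + 1) → X, ∏ i : Fin (m + 1), M i (x i) (x (finRotate (m + 1) i))
      = (∏ i : Fin m, M i (x i.castSucc) (x i.succ)) * M m (x (Fin.last m)) (x 0) := by
    intro x
    rw [Fin.prod_univ_castSucc, finRotate_last]
    congr 1
    refine Finset.prod_congr rfl fun i _ => ?_
    rw [finRotate_apply, Fin.coeSucc_eq_succ, Fin.val_castSucc]
  simp only [h1]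
  rw [cy_open_walk M m (fun u v => M m v u)]
  simp only [Matrix.trace, Matrix.diag_apply, cyP, Matrix.mul_apply]

lemma cy_const_walk {X : Type*} [Fintype X] [DecidableEq X] (A : Matrix X X ℝ) (m : ℕ) :
    ∑ x : Fin (m + 1) → X, ∏ i : Fin (m + 1), A (x i) (x (finRotate (m + 1) i))
      = Matrix.trace (A ^ (m + 1)) := by
  have h : ∀ k, cyP (fun _ => A) k = A ^ k := by
    intro k
    induction k with
    | zero => simp [cyP]
    | succ k ih => rw [cyP, ih, pow_succ]
  rw [← h]
  exact cy_closed_walk (fun _ => A) m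

lemma cy_pair_walk {X : Type*} [Fintype X] [DecidableEq X] (A : Matrix X X ℝ) (m : ℕ)
    (i j : Fin (m + 1)) (hij : i < j) :
    ∑ x : Fin (m + 1) → X, (if x i = x j then 1 else 0)
        * ∏ k : Fin (m + 1), A (x k) (x (finRotate (m + 1) k))
      = ∑ z, (A ^ ((j : ℕ) - i)) z z * (A ^ (m + 1 - ((j : ℕ) - i))) z z := by
  set M : X → ℕ → Matrix X X ℝ := fun z k =>
    if k = i ∨ k = j then Matrix.single z z 1 * A else A with hM
  have hEA : ∀ z u v, (Matrix.single z z (1 : ℝ) * A) u v = (if u = z then 1 else 0) * A u v := by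
    intro z u v
    by_cases h : u = z
    · subst h; simp
    · simp [h]
  have h1 : ∀ x : Fin (m + 1) → X, (if x i = x j then 1 else 0)
        * ∏ k : Fin (m + 1), A (x k) (x (finRotate (m + 1) k))
      = ∑ z, ∏ k : Fin (m + 1), M z k (x k) (x (finRotate (m + 1) k)) := by
    intro x
    have h2 : ∀ z, ∏ k : Fin (m + 1), M z k (x k) (x (finRotate (m + 1) k))
        = ((if x i = z then 1 else 0) * (if x j = z then 1 else 0)) *
          ∏ k : Fin (m + 1), A (x k) (x (finRotate (m + 1) k)) := by
      intro z
      have h3 : ∀ k : Fin (m + 1), M z k (x k) (x (finRotate (m + 1) k))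
          = ((if k = i then (if x i = z then 1 else 0) else 1) *
            (if k = j then (if x j = z then 1 else 0) else 1)) *
            A (x k) (x (finRotate (m + 1) k)) := by
        intro k
        simp only [hM]
        by_cases hi : k = i
        · have hj : k ≠ j := by rw [hi]; exact hij.ne
          rw [if_pos (by left; rw [hi]), hEA, if_pos hi, if_neg hj, hi, mul_one]
        · by_cases hj : k = j
          · rw [if_pos (by right; rw [hj]), hEA, if_neg hi, if_pos hj, hj, one_mul]
          · rw [if_neg, if_neg hi, if_neg hj, one_mul, one_mul]
            rintro (h | h)
            · exact hi (Fin.ext h)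
            · exact hj (Fin.ext h)
      simp only [h3, Finset.prod_mul_distrib, Finset.prod_ite_eq', Finset.mem_univ, if_true]
    simp only [h2, ← Finset.sum_mul]
    congr 1
    simp only [mul_ite, mul_one, mul_zero]
    rw [Finset.sum_ite_eq]
    simp
  simp only [h1]
  rw [Finset.sum_comm]
  refine Finset.sum_congr rfl fun z _ => ?_
  rw [cy_closed_walk (M z) m]
  set E : Matrix X X ℝ := Matrix.single z z 1 with hE
  have hP1 : ∀ k : ℕ, k ≤ i → cyP (M z) k = A ^ k := by
    intro k
    induction k with
    | zero => intro _; simp [cyP]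
    | succ k ih =>
      intro hk
      have hij' : (i : ℕ) < j := hij
      rw [cyP, ih (by omega), pow_succ]
      simp only [hM]
      rw [if_neg (by omega)]
  have hP2 : ∀ s : ℕ, (i : ℕ) + s + 1 ≤ j → cyP (M z) (i + s + 1) = A ^ (i : ℕ) * E * A ^ (s + 1) := by
    intro s
    induction s with
    | zero =>
      intro _
      rw [cyP]
      rw [hP1 i le_rfl]
      simp only [hM]
      rw [if_pos (by simp)]
      simp [Matrix.mul_assoc, hE]
    | succ s ih =>
      intro hk
      rw [cyP]
      have : (i : ℕ) + (s + 1) = i + s + 1 := by ring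
      rw [this, ih (by omega)]
      simp only [hM]
      rw [if_neg (by omega), pow_succ A (s + 1), Matrix.mul_assoc _ _ A]
  obtain ⟨s, hs⟩ : ∃ s, (j : ℕ) = i + s + 1 := ⟨j - i - 1, by
    have hij' : (i : ℕ) < j := hij
    omega⟩
  have hP3 : ∀ r : ℕ, cyP (M z) (j + r + 1) = A ^ (i : ℕ) * E * A ^ (s + 1) * E * A ^ (r + 1) := by
    intro r
    induction r with
    | zero =>
      have h5 := hP2 s hs.ge
      rw [← hs] at h5
      rw [cyP]
      rw [h5]
      simp only [hM]
      rw [if_pos (by simp)]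
      simp [Matrix.mul_assoc, hE]
    | succ r ih =>
      rw [cyP]
      have : (j : ℕ) + (r + 1) = j + r + 1 := by ring
      rw [this, ih]
      simp only [hM]
      rw [if_neg (by omega), pow_succ A (r + 1), Matrix.mul_assoc _ _ A]
  obtain ⟨r, hr⟩ : ∃ r, m + 1 = (j : ℕ) + r + 1 := ⟨m - j, by have := j.isLt; omega⟩
  have e1 : (j : ℕ) - i = s + 1 := by omega
  have e2 : m + 1 - (s + 1) = r + 1 + i := by omega
  rw [e1, e2]
  have e3 : cyP (M z) (m + 1) = A ^ (i : ℕ) * E * A ^ (s + 1) * E * A ^ (r + 1) := by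
    rw [← hP3, ← hr]
  rw [e3]
  have hEx : ∀ a b, E a b = (if a = z then 1 else 0) * (if b = z then 1 else 0) := by
    intro a b
    rw [hE, Matrix.single_apply]
    by_cases ha : a = z
    · by_cases hb : b = z
      · simp [ha, hb]
      · simp [hb, Ne.symm hb]
    · simp [ha, Ne.symm ha]
  have e4 : ∀ B : Matrix X X ℝ, E * B * E = B z z • E := by
    intro B
    ext a b
    rw [Matrix.smul_apply, Matrix.mul_apply]
    simp only [Matrix.mul_apply, hEx]
    by_cases ha : a = z <;> by_cases hb : b = z <;> simp [ha, hb]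
  have e5 : ∀ B : Matrix X X ℝ, Matrix.trace (E * B) = B z z := by
    intro B
    simp only [Matrix.trace, Matrix.mul_apply, Matrix.diag_apply, hEx]
    simp
  calc _ = Matrix.trace (A ^ (i : ℕ) * (E * A ^ (s + 1) * E * A ^ (r + 1))) := by
        simp only [Matrix.mul_assoc]
    _ = Matrix.trace ((E * A ^ (s + 1) * E) * A ^ (r + 1) * A ^ (i : ℕ)) := by
        rw [Matrix.trace_mul_comm]
    _ = _ := by
        rw [e4, Matrix.smul_mul, Matrix.smul_mul, Matrix.trace_smul, Matrix.mul_assoc, e5, smul_eq_mul,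
          ← pow_add]

lemma cy_cycle_count {X : Type*} [Fintype X] [DecidableEq X] (A : Matrix X X ℝ) (m : ℕ)
    (hA0 : ∀ x y, 0 ≤ A x y) (C : ℝ)
    (hC : C = ∑ x : Fin (m + 1) → X, (if Function.Injective x then 1 else 0)
        * ∏ k : Fin (m + 1), A (x k) (x (finRotate (m + 1) k))) :
    0 ≤ C ∧ C ≤ Matrix.trace (A ^ (m + 1)) ∧
    Matrix.trace (A ^ (m + 1)) - C ≤
      ∑ p ∈ (Finset.univ : Finset (Fin (m + 1) × Fin (m + 1))).filter (fun p => p.1 < p.2),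
        ∑ z, (A ^ ((p.2 : ℕ) - p.1)) z z * (A ^ (m + 1 - ((p.2 : ℕ) - p.1))) z z := by
  have hpos : ∀ x : Fin (m + 1) → X, 0 ≤ ∏ k : Fin (m + 1), A (x k) (x (finRotate (m + 1) k)) :=
    fun x => Finset.prod_nonneg fun k _ => hA0 _ _
  refine ⟨?_, ?_, ?_⟩
  · rw [hC]
    refine Finset.sum_nonneg fun x _ => mul_nonneg ?_ (hpos x)
    split_ifs <;> norm_num
  · rw [hC, ← cy_const_walk]
    refine Finset.sum_le_sum fun x _ => ?_
    refine mul_le_of_le_one_left (hpos x) ?_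
    split_ifs <;> norm_num
  · rw [hC, ← cy_const_walk, ← Finset.sum_sub_distrib]
    have h1 : ∀ p ∈ (Finset.univ : Finset (Fin (m + 1) × Fin (m + 1))).filter (fun p => p.1 < p.2),
        ∑ z, (A ^ ((p.2 : ℕ) - p.1)) z z * (A ^ (m + 1 - ((p.2 : ℕ) - p.1))) z z
        = ∑ x : Fin (m + 1) → X, (if x p.1 = x p.2 then 1 else 0)
        * ∏ k : Fin (m + 1), A (x k) (x (finRotate (m + 1) k)) := by
      intro p hp
      rw [cy_pair_walk A m p.1 p.2 (by simpa using hp)]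
    rw [Finset.sum_congr rfl h1, Finset.sum_comm]
    refine Finset.sum_le_sum fun x _ => ?_
    rw [← Finset.sum_mul]
    by_cases hx : Function.Injective x
    · rw [if_pos hx, one_mul, sub_self]
      refine mul_nonneg (Finset.sum_nonneg fun p _ => ?_) (hpos x)
      split_ifs <;> norm_num
    · rw [if_neg hx, zero_mul, sub_zero]
      refine le_mul_of_one_le_left (hpos x) ?_
      obtain ⟨i, j, hij, hlt⟩ : ∃ i j, x i = x j ∧ i < j := by
        rw [Function.Injective] at hx
        push Not at hx
        obtain ⟨i, j, h, hne⟩ := hx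
        rcases lt_or_gt_of_ne hne with h' | h'
        · exact ⟨i, j, h, h'⟩
        · exact ⟨j, i, h.symm, h'⟩
      have := Finset.single_le_sum (f := fun p : Fin (m + 1) × Fin (m + 1) =>
        if x p.1 = x p.2 then (1 : ℝ) else 0)
        (s := (Finset.univ : Finset (Fin (m + 1) × Fin (m + 1))).filter (fun p => p.1 < p.2))
        (fun p _ => by split_ifs <;> norm_num) (a := (i, j)) (by simpa using hlt)
      simpa [hij] using this

end WalkPart

section Combine

open Classical in
lemma cy_degree {F : Type} [Field F] [Fintype F] (hF : ringChar F ≠ 2)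
    {d : ℕ} (Q : QuadraticForm F (Fin d → F))
    (hQ : ∀ x, (∀ y, QuadraticMap.polar (⇑Q) x y = 0) → x = 0) (t : F) (ht : t ≠ 0)
    (x : Fin d → F) :
    ∑ y, (if Q (x - y) = t then (1 : ℝ) else 0)
      ≤ (Fintype.card F : ℝ) ^ d / Fintype.card F
        + 2 * Real.sqrt (Fintype.card F) ^ (d + 1) / Fintype.card F := by
  have h := (abs_le.mp (cy_form_bound hF Q hQ t ht (fun _ => 1))).2
  have hc : (0 : ℝ) < Fintype.card F := by exact_mod_cast Fintype.card_pos
  have e : ∀ z, ∑ y, (if Q (z - y) = t then (1 : ℝ) else 0)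
      = ∑ y, (if Q y = t then (1 : ℝ) else 0) := by
    intro z
    exact Fintype.sum_equiv (Equiv.subLeft z) _ _ (fun y => rfl)
  simp only [one_mul, e, one_pow, Finset.sum_const, Finset.card_univ, nsmul_eq_mul, mul_one] at h
  rw [e]
  have hV : (Fintype.card (Fin d → F) : ℝ) = (Fintype.card F : ℝ) ^ d := by simp
  rw [hV] at h
  have hpos : (0 : ℝ) < (Fintype.card F : ℝ) ^ d := by positivity
  refine le_of_mul_le_mul_left ?_ hpos
  have : (Fintype.card F : ℝ) ^ d * ((Fintype.card F : ℝ) ^ d / Fintype.card F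
        + 2 * Real.sqrt (Fintype.card F) ^ (d + 1) / Fintype.card F)
      = ((Fintype.card F : ℝ) ^ d) ^ 2 / Fintype.card F
        + 2 * Real.sqrt (Fintype.card F) ^ (d + 1) / Fintype.card F * (Fintype.card F : ℝ) ^ d := by
    ring
  rw [this]
  linarith

lemma cy_combine {F : Type} [Field F] [Fintype F] (hF : ringChar F ≠ 2)
    {d : ℕ} (Q : QuadraticForm F (Fin d → F))
    (hQ : ∀ x, (∀ y, QuadraticMap.polar (⇑Q) x y = 0) → x = 0) (t : F) (ht : t ≠ 0)
    (E : Finset (Fin d → F)) (hE : E.Nonempty) (n : ℕ) (hn : 4 ≤ n) (q N X0 L ρ D C : ℝ)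
    (hq : q = Fintype.card F) (hN : N = E.card) (hX0 : X0 = N / q)
    (hL : L = 2 * Real.sqrt q ^ (d + 1) / q) (hρ : ρ = X0 + L) (hD : D = q ^ d / q + L)
    (hC : C = (Nat.card {x : Fin n → (Fin d → F) // Function.Injective x ∧
            (∀ i, x i ∈ E) ∧
            ∀ i : Fin n, Q (x i - x (finRotate n i)) = t} : ℝ)) :
    ∃ T : ℝ, |T - X0 ^ n| ≤ (ρ ^ n - X0 ^ n) + L ^ (n - 2) * (N * ρ) ∧ 0 ≤ C ∧ C ≤ T ∧
      T - C ≤ (n : ℝ) ^ 2 * (ρ ^ (n - 2) * N) ∧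
      (n = 5 → T - C ≤ 10 * (D * (ρ ^ 3 + L * (N * ρ)))) ∧
      (n = 6 → T - C ≤ 15 * (D * (ρ ^ 4 + L ^ 2 * (N * ρ)))) := by
  classical
  have hq0 : 0 < q := by rw [hq]; exact_mod_cast Fintype.card_pos
  have hL0 : 0 ≤ L := by rw [hL]; positivity
  have hN0 : 0 ≤ N := by rw [hN]; positivity
  have hX00 : 0 ≤ X0 := by rw [hX0]; positivity
  have hρ0 : 0 ≤ ρ := by rw [hρ]; positivity
  set A : Matrix E E ℝ := Matrix.of fun x y => if Q ((x : Fin d → F) - y) = t then 1 else 0 with hA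
  have hAx : ∀ x y : E, A x y = if Q ((x : Fin d → F) - y) = t then 1 else 0 := fun x y => rfl
  have hA01 : ∀ x y, A x y = 0 ∨ A x y = 1 := by
    intro x y; rw [hAx]; split_ifs <;> simp
  have hA0 : ∀ x y, 0 ≤ A x y := by
    intro x y; rcases hA01 x y with h | h <;> rw [h]; norm_num
  have hAdiag : ∀ x, A x x = 0 := by
    intro x; rw [hAx, sub_self, QuadraticMap.map_zero, if_neg ht.symm]
  have hAs : A.transpose = A := by
    ext x y
    rw [Matrix.transpose_apply, hAx, hAx, QuadraticMap.map_sub]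
  have : Nonempty E := hE.to_subtype
  have hext : ∀ g : (Fin d → F) → ℝ, ∑ x, (if x ∈ E then g x else 0) = ∑ x : E, g x := by
    intro g
    rw [← Finset.sum_filter, Finset.sum_coe_sort E g]
    congr 1
    ext; simp
  have hform : ∀ a : E → ℝ, |∑ x, ∑ y, a x * a y * A x y - (∑ x, a x) ^ 2 * (1 / q)|
      ≤ L * ∑ x, a x ^ 2 := by
    intro a
    set b : (Fin d → F) → ℝ := fun x => if h : x ∈ E then a ⟨x, h⟩ else 0 with hb
    have hbE : ∀ x : E, b x = a x := by
      intro x; simp [hb]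
    have hbn : ∀ x, x ∉ E → b x = 0 := by
      intro x hx; simp [hb, hx]
    have hsum : ∀ g : (Fin d → F) → ℝ, (∀ x, x ∉ E → g x = 0) → ∑ x, g x = ∑ x : E, g x := by
      intro g hg
      rw [← hext]
      refine Finset.sum_congr rfl fun x _ => ?_
      split_ifs with h
      · rfl
      · exact hg x h
    have h := cy_form_bound hF Q hQ t ht b
    rw [hsum (fun x => ∑ y, b x * b y * (if Q (x - y) = t then 1 else 0))
        (fun x hx => by simp [hbn x hx]), hsum b hbn,
        hsum (fun x => b x ^ 2) (fun x hx => by simp [hbn x hx])] at h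
    have e : ∀ x : E, ∑ y, b x * b y * (if Q ((x : Fin d → F) - y) = t then 1 else 0)
        = ∑ y, a x * a y * A x y := by
      intro x
      rw [hsum (fun y => b x * b y * (if Q ((x : Fin d → F) - y) = t then 1 else 0))
        (fun y hy => by simp [hbn y hy])]
      refine Finset.sum_congr rfl fun y _ => ?_
      rw [hbE, hbE, hAx]
    rw [Finset.sum_congr rfl fun x _ => e x] at h
    simp only [hbE] at h
    rw [hL, hq]
    rw [mul_one_div]
    exact h
  have hdeg : ∀ z, ∑ w, A z w ≤ D := by
    intro z
    rw [hD, hL, hq]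
    refine le_trans ?_ (cy_degree hF Q hQ t ht z)
    simp only [hAx]
    rw [← hext (fun y => if Q ((z : Fin d → F) - y) = t then (1 : ℝ) else 0)]
    refine Finset.sum_le_sum fun y _ => ?_
    by_cases hy : y ∈ E
    · rw [if_pos hy]
    · rw [if_neg hy]; split_ifs <;> norm_num
  obtain ⟨g1, g2, g3, g4⟩ := cy_graph A hAs hA01 (1 / q) L D (by positivity) hL0 hform hdeg N X0 ρ
    (by rw [hN]; simp) (by rw [hX0]; ring) hρ
  obtain ⟨m, rfl⟩ : ∃ m, n = m + 1 := ⟨n - 1, by omega⟩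
  have hC2 : C = ∑ x : Fin (m + 1) → E, (if Function.Injective x then 1 else 0)
        * ∏ k : Fin (m + 1), A (x k) (x (finRotate (m + 1) k)) := by
    have e1 : Nat.card {x : Fin (m + 1) → (Fin d → F) // Function.Injective x ∧
            (∀ i, x i ∈ E) ∧ ∀ i : Fin (m + 1), Q (x i - x (finRotate (m + 1) i)) = t}
        = Nat.card {x : Fin (m + 1) → E // Function.Injective x ∧
          ∀ i : Fin (m + 1), Q ((x i : Fin d → F) - x (finRotate (m + 1) i)) = t} := by
      refine Nat.card_congr
        { toFun := fun x => ⟨fun i => ⟨x.1 i, x.2.2.1 i⟩, ?_, ?_⟩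
          invFun := fun x => ⟨fun i => (x.1 i : Fin d → F), ?_, ?_, ?_⟩
          left_inv := ?_
          right_inv := ?_ }
      · intro i j h
        exact x.2.1 (congrArg Subtype.val h)
      · exact x.2.2.2
      · intro i j h
        exact x.2.1 (Subtype.ext h)
      · intro i; exact (x.1 i).2
      · exact x.2.2
      · intro x; rfl
      · intro x; rfl
    rw [hC, e1, Nat.card_eq_fintype_card, Fintype.card_subtype, Finset.card_filter]
    push_cast
    refine Finset.sum_congr rfl fun x _ => ?_
    simp only [hAx]
    rw [Finset.prod_ite_zero]
    by_cases h1 : Function.Injective x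
    · by_cases h2 : ∀ i : Fin (m + 1), Q ((x i : Fin d → F) - x (finRotate (m + 1) i)) = t
      · rw [if_pos ⟨h1, h2⟩, if_pos h1, if_pos (fun i _ => h2 i)]; simp
      · rw [if_neg (fun h => h2 h.2), if_pos h1, if_neg (fun h => h2 fun i => h i (Finset.mem_univ i))]
        simp
    · rw [if_neg (fun h => h1 h.1), if_neg h1, zero_mul]
  obtain ⟨c1, c2, c3⟩ := cy_cycle_count A m hA0 C hC2
  refine ⟨Matrix.trace (A ^ (m + 1)), ?_, c1, c2, ?_, ?_, ?_⟩
  · have := g1 (m - 1)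
    have e : m - 1 + 2 = m + 1 := by omega
    rw [e] at this
    have e2 : m + 1 - 2 = m - 1 := by omega
    rw [e2]; exact this
  · refine c3.trans ?_
    have hb : ∀ p ∈ (Finset.univ : Finset (Fin (m + 1) × Fin (m + 1))).filter (fun p => p.1 < p.2),
        ∑ z, (A ^ ((p.2 : ℕ) - p.1)) z z * (A ^ (m + 1 - ((p.2 : ℕ) - p.1))) z z
          ≤ ρ ^ (m + 1 - 2) * N := by
      intro p hp
      have hlt : (p.1 : ℕ) < p.2 := by simpa using hp
      have hlt2 := p.2.isLt
      have hnn : 0 ≤ ρ ^ (m + 1 - 2) * N := by positivity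
      obtain ⟨a, ha⟩ : ∃ a, (p.2 : ℕ) - p.1 = a := ⟨_, rfl⟩
      rw [ha]
      by_cases h1 : a = 1
      · rw [h1]
        simp only [pow_one, hAdiag, zero_mul, Finset.sum_const_zero]
        exact hnn
      by_cases h2 : m + 1 - a = 1
      · rw [h2]
        simp only [pow_one, hAdiag, mul_zero, Finset.sum_const_zero]
        exact hnn
      obtain ⟨a', ha'⟩ : ∃ a', a = a' + 2 := ⟨a - 2, by omega⟩
      obtain ⟨b', hb'⟩ : ∃ b', m + 1 - a = b' + 2 := ⟨m + 1 - a - 2, by omega⟩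
      rw [hb', ha']
      have := g2 a' b'
      have e : a' + b' + 2 = m + 1 - 2 := by omega
      rw [e] at this
      exact this
    refine (Finset.sum_le_sum hb).trans ?_
    rw [Finset.sum_const, nsmul_eq_mul]
    refine mul_le_mul_of_nonneg_right ?_ (by positivity)
    have hcard : ((Finset.univ : Finset (Fin (m + 1) × Fin (m + 1))).filter
        (fun p => p.1 < p.2)).card ≤ (m + 1) ^ 2 := by
      refine (Finset.card_filter_le _ _).trans ?_
      simp [sq]
    exact_mod_cast hcard
  · intro h5
    obtain rfl : m = 4 := by omega
    refine c3.trans ?_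
    have hD0 : 0 ≤ D := by rw [hD]; positivity
    have hb : ∀ p ∈ (Finset.univ : Finset (Fin (4 + 1) × Fin (4 + 1))).filter (fun p => p.1 < p.2),
        ∑ z, (A ^ ((p.2 : ℕ) - p.1)) z z * (A ^ (4 + 1 - ((p.2 : ℕ) - p.1))) z z
          ≤ D * (ρ ^ 3 + L * (N * ρ)) := by
      intro p hp
      have hlt : (p.1 : ℕ) < p.2 := by simpa using hp
      have hlt2 := p.2.isLt
      have hnn : 0 ≤ D * (ρ ^ 3 + L * (N * ρ)) := by positivity
      obtain ⟨a, ha⟩ : ∃ a, (p.2 : ℕ) - p.1 = a := ⟨_, rfl⟩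
      rw [ha]
      have ha4 : a ≤ 4 := by omega
      have ha1 : 1 ≤ a := by omega
      have h3 := g3 1
      interval_cases a
      · simp only [pow_one, hAdiag, zero_mul, Finset.sum_const_zero]
        exact hnn
      · simpa using h3
      · simp only [mul_comm ((A ^ 3) _ _)]
        simpa using h3
      · simp only [Nat.reduceAdd, Nat.reduceSub, pow_one, hAdiag, mul_zero, Finset.sum_const_zero]
        exact hnn
    refine (Finset.sum_le_sum hb).trans ?_
    rw [Finset.sum_const, nsmul_eq_mul]
    have hcard : ((Finset.univ : Finset (Fin (4 + 1) × Fin (4 + 1))).filter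
        (fun p => p.1 < p.2)).card = 10 := by decide
    rw [hcard]
    norm_num
  · intro h6
    obtain rfl : m = 5 := by omega
    refine c3.trans ?_
    have hD0 : 0 ≤ D := by rw [hD]; positivity
    have hb : ∀ p ∈ (Finset.univ : Finset (Fin (5 + 1) × Fin (5 + 1))).filter (fun p => p.1 < p.2),
        ∑ z, (A ^ ((p.2 : ℕ) - p.1)) z z * (A ^ (5 + 1 - ((p.2 : ℕ) - p.1))) z z
          ≤ D * (ρ ^ 4 + L ^ 2 * (N * ρ)) := by
      intro p hp
      have hlt : (p.1 : ℕ) < p.2 := by simpa using hp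
      have hlt2 := p.2.isLt
      have hnn : 0 ≤ D * (ρ ^ 4 + L ^ 2 * (N * ρ)) := by positivity
      obtain ⟨a, ha⟩ : ∃ a, (p.2 : ℕ) - p.1 = a := ⟨_, rfl⟩
      rw [ha]
      have ha4 : a ≤ 5 := by omega
      have ha1 : 1 ≤ a := by omega
      have h3 := g3 2
      interval_cases a
      · simp only [pow_one, hAdiag, zero_mul, Finset.sum_const_zero]
        exact hnn
      · simpa using h3
      · simpa using g4
      · simp only [mul_comm ((A ^ 4) _ _)]
        simpa using h3
      · simp only [Nat.reduceAdd, Nat.reduceSub, pow_one, hAdiag, mul_zero, Finset.sum_const_zero]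
        exact hnn
    refine (Finset.sum_le_sum hb).trans ?_
    rw [Finset.sum_const, nsmul_eq_mul]
    have hcard : ((Finset.univ : Finset (Fin (5 + 1) × Fin (5 + 1))).filter
        (fun p => p.1 < p.2)).card = 15 := by decide
    rw [hcard]
    norm_num

end Combine

section FinalPart

lemma cy_one_add_pow (x : ℝ) (hx : 0 ≤ x) (hx1 : x ≤ 1) (n : ℕ) : (1 + x) ^ n ≤ 1 + 2 ^ n * x := by
  have key : (1 + x) ^ n ≤ 1 + (2 ^ n - 1) * x := by
    induction n with
    | zero => simp
    | succ n ih =>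
      have h2 : (0 : ℝ) ≤ 2 ^ n - 1 := sub_nonneg.mpr (one_le_pow₀ (by norm_num))
      have hxx : x * x ≤ x := by nlinarith
      have h4 := mul_le_mul_of_nonneg_left hxx h2
      calc (1 + x) ^ (n + 1) = (1 + x) ^ n * (1 + x) := pow_succ _ _
        _ ≤ (1 + (2 ^ n - 1) * x) * (1 + x) := mul_le_mul_of_nonneg_right ih (by linarith)
        _ ≤ 1 + (2 ^ (n + 1) - 1) * x := by
            rw [pow_succ]
            linarith
  linarith

set_option maxHeartbeats 2000000 in
/-- The final numerical estimate. -/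
lemma cy_numeric (d n : ℕ) (hd : 2 ≤ d) (hn : 4 ≤ n)
    (q N X0 L ρ D C T K θ τ B : ℝ) (hq4 : 4 ≤ q) (hN0 : 0 < N) (hX0 : X0 = N / q)
    (hL0 : 0 ≤ L) (hρ : ρ = X0 + L) (hD : D = q ^ d / q + L)
    (hτ0 : 0 < τ) (hLX : L ≤ 2 * τ * X0)
    (hθ : q * τ ^ (n - 2) = θ) (hsmall : 2 ^ (n + 10) * (n : ℝ) ^ 2 * τ ≤ θ) (hθ1 : θ ≤ 1)
    (hd3 : 3 ≤ d → q ≤ τ * X0) (hd2 : d = 2 → L ^ 2 = 4 * q)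
    (hd24 : ¬ (d = 2 ∧ n = 4))
    (hB : 0 ≤ B) (hB1 : d = 2 → 7 ≤ n → 1 ≤ B)
    (hK : 2 ^ (n - 1) + 2 ≤ K) (hK5 : n = 5 → 98 ≤ K) (hK6 : n = 6 → 274 ≤ K)
    (hT : |T - X0 ^ n| ≤ (ρ ^ n - X0 ^ n) + L ^ (n - 2) * (N * ρ)) (hC0 : 0 ≤ C) (hCT : C ≤ T)
    (hTC : T - C ≤ (n : ℝ) ^ 2 * (ρ ^ (n - 2) * N))
    (hTC5 : n = 5 → T - C ≤ 10 * (D * (ρ ^ 3 + L * (N * ρ))))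
    (hTC6 : n = 6 → T - C ≤ 15 * (D * (ρ ^ 4 + L ^ 2 * (N * ρ)))) :
    |C - X0 ^ n| ≤ X0 ^ n * (K * θ + B) := by
  have hq0 : 0 < q := by linarith
  have hX : 0 < X0 := by rw [hX0]; positivity
  have hNX : N = q * X0 := by rw [hX0]; field_simp
  have hn4 : (4 : ℝ) ≤ n := by exact_mod_cast hn
  have hθ0 : 0 < θ := by rw [← hθ]; positivity
  have h2n : (16 : ℝ) ≤ 2 ^ n := by
    calc (16 : ℝ) = 2 ^ 4 := by norm_num
      _ ≤ 2 ^ n := pow_le_pow_right₀ (by norm_num) hn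
  have hsm1 : 2 ^ (n + 10) * τ ≤ θ := by
    refine le_trans ?_ hsmall
    have : (1 : ℝ) ≤ (n : ℝ) ^ 2 := by nlinarith
    have h3 : (0 : ℝ) < 2 ^ (n + 10) * τ := by positivity
    nlinarith
  have hsm2 : 1024 * (2 ^ n * τ) ≤ θ := by
    calc _ = 2 ^ (n + 10) * τ := by rw [pow_add]; ring
      _ ≤ θ := hsm1
  have hτs : 16384 * τ ≤ θ := by nlinarith
  have hτ1 : 2 * τ ≤ 1 := by linarith
  have hρX : ρ ≤ X0 * (1 + 2 * τ) := by rw [hρ]; linarith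
  have hρ2 : ρ ≤ 2 * X0 := by nlinarith
  have hρ0 : 0 ≤ ρ := by rw [hρ]; positivity
  have hXn : 0 < X0 ^ n := by positivity
  have hpow : X0 ^ n = X0 ^ (n - 2) * X0 ^ 2 := by rw [← pow_add]; congr 1; omega
  have hpow2 : (2 : ℝ) ^ n = 2 ^ (n - 2) * 4 := by
    have : n = n - 2 + 2 := by omega
    conv_lhs => rw [this, pow_add]
    norm_num
  have hpow1 : (2 : ℝ) ^ (n - 1) = 2 ^ (n - 2) * 2 := by
    have : n - 1 = n - 2 + 1 := by omega
    rw [this, pow_succ]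
  -- first error term
  have hE1 : ρ ^ n - X0 ^ n ≤ X0 ^ n * (2 ^ n * (2 * τ)) := by
    have h1 : ρ ^ n ≤ X0 ^ n * (1 + 2 * τ) ^ n := by
      rw [← mul_pow]; exact pow_le_pow_left₀ hρ0 hρX n
    have h2 := mul_le_mul_of_nonneg_left
      (cy_one_add_pow (2 * τ) (by positivity) hτ1 n) hXn.le
    linarith
  have hE2 : L ^ (n - 2) * (N * ρ) ≤ X0 ^ n * (2 ^ (n - 1) * θ) := by
    have h1 : L ^ (n - 2) ≤ (2 * τ * X0) ^ (n - 2) := pow_le_pow_left₀ hL0 hLX _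
    have h2 : N * ρ ≤ q * X0 * (2 * X0) := by
      rw [hNX]; exact mul_le_mul_of_nonneg_left hρ2 (by positivity)
    calc _ ≤ (2 * τ * X0) ^ (n - 2) * (q * X0 * (2 * X0)) :=
          mul_le_mul h1 h2 (by positivity) (by positivity)
      _ = X0 ^ n * (2 ^ (n - 1) * θ) := by
          rw [← hθ, hpow, hpow1, mul_pow, mul_pow]; ring
  have hTT : |T - X0 ^ n| ≤ X0 ^ n * (2 ^ (n - 1) * θ + θ) := by
    refine hT.trans ((add_le_add hE1 hE2).trans ?_)
    rw [← mul_add]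
    refine mul_le_mul_of_nonneg_left ?_ hXn.le
    have : 0 < 2 ^ n * τ := by positivity
    nlinarith
  have habs : |C - X0 ^ n| ≤ |T - X0 ^ n| + (T - C) := by
    have e : C - X0 ^ n = (T - X0 ^ n) + (-(T - C)) := by ring
    rw [e]
    refine (abs_add_le _ _).trans ?_
    rw [abs_neg, abs_of_nonneg (sub_nonneg.mpr hCT)]
  -- it suffices to bound T - C
  have hsuff : ∀ M : ℝ, T - C ≤ X0 ^ n * (M * θ) → 2 ^ (n - 1) + 1 + M ≤ K →
      |C - X0 ^ n| ≤ X0 ^ n * (K * θ + B) := by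
    intro M hM hMK
    refine habs.trans ((add_le_add hTT hM).trans ?_)
    rw [← mul_add]
    refine mul_le_mul_of_nonneg_left ?_ hXn.le
    have := mul_le_mul_of_nonneg_right hMK hθ0.le
    nlinarith
  by_cases h3 : 3 ≤ d
  · refine hsuff 1 (hTC.trans ?_) (by linarith)
    have h1 : ρ ^ (n - 2) ≤ (2 * X0) ^ (n - 2) := pow_le_pow_left₀ hρ0 hρ2 _
    have h2 : N ≤ τ * X0 * X0 := by
      rw [hNX]; exact mul_le_mul_of_nonneg_right (hd3 h3) hX.le
    calc (n : ℝ) ^ 2 * (ρ ^ (n - 2) * N) ≤ (n : ℝ) ^ 2 * ((2 * X0) ^ (n - 2) * (τ * X0 * X0)) := by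
          refine mul_le_mul_of_nonneg_left ?_ (by positivity)
          exact mul_le_mul h1 h2 hN0.le (by positivity)
      _ = X0 ^ n * (2 ^ (n - 2) * (n : ℝ) ^ 2 * τ) := by rw [hpow, mul_pow]; ring
      _ ≤ X0 ^ n * (1 * θ) := by
          refine mul_le_mul_of_nonneg_left ?_ hXn.le
          rw [one_mul]
          refine le_trans ?_ hsmall
          refine mul_le_mul_of_nonneg_right ?_ hτ0.le
          refine mul_le_mul_of_nonneg_right ?_ (by positivity)
          exact pow_le_pow_right₀ (by norm_num) (by omega)
  have hd' : d = 2 := by omega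
  by_cases h7 : 7 ≤ n
  · have hB1' := hB1 hd' h7
    rw [abs_le]
    constructor
    · have : X0 ^ n * 1 ≤ X0 ^ n * (K * θ + B) := by
        refine mul_le_mul_of_nonneg_left ?_ hXn.le
        have h2n1 : (0 : ℝ) < 2 ^ (n - 1) := by positivity
        have : 0 ≤ K * θ := mul_nonneg (by linarith) hθ0.le
        linarith
      linarith
    · have h1 := (abs_le.mp hTT).2
      have : X0 ^ n * (2 ^ (n - 1) * θ + θ) ≤ X0 ^ n * (K * θ + B) := by
        refine mul_le_mul_of_nonneg_left ?_ hXn.le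
        have := mul_le_mul_of_nonneg_right hK hθ0.le
        linarith
      linarith
  have hL2 := hd2 hd'
  have hDb : D ≤ 2 * τ ^ 2 * X0 ^ 2 := by
    have h1 : D = q + L := by
      rw [hD, hd']
      congr 1
      field_simp
    have h2 : L ≤ q := by
      exact (pow_le_pow_iff_left₀ hL0 hq0.le two_ne_zero).mp
        (by rw [hL2, sq]; exact mul_le_mul_of_nonneg_right hq4 hq0.le)
    have h4 : L ^ 2 ≤ (2 * τ * X0) ^ 2 := pow_le_pow_left₀ hL0 hLX 2
    have h5 : (2 * τ * X0) ^ 2 = 4 * (τ ^ 2 * X0 ^ 2) := by ring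
    have h6 : 2 * τ ^ 2 * X0 ^ 2 = 2 * (τ ^ 2 * X0 ^ 2) := by ring
    linarith
  have hD0 : 0 ≤ D := by rw [hD]; positivity
  have hn56 : n = 5 ∨ n = 6 := by
    have : n ≠ 4 := fun h => hd24 ⟨hd', h⟩
    omega
  have hττ : τ ^ 2 ≤ τ := by
    rw [sq]; exact mul_le_of_le_one_left hτ0.le (by linarith)
  rcases hn56 with h5 | h6
  · subst h5
    norm_num at hθ
    refine hsuff 81 ((hTC5 rfl).trans ?_) (by have := hK5 rfl; norm_num; linarith)
    have h1 : ρ ^ 3 + L * (N * ρ) ≤ (2 * X0) ^ 3 + 2 * τ * X0 * (q * X0 * (2 * X0)) := by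
      refine add_le_add (pow_le_pow_left₀ hρ0 hρ2 3) ?_
      refine mul_le_mul hLX ?_ (by positivity) (by positivity)
      rw [hNX]; exact mul_le_mul_of_nonneg_left hρ2 (by positivity)
    calc 10 * (D * (ρ ^ 3 + L * (N * ρ)))
        ≤ 10 * (2 * τ ^ 2 * X0 ^ 2 * ((2 * X0) ^ 3 + 2 * τ * X0 * (q * X0 * (2 * X0)))) := by
          refine mul_le_mul_of_nonneg_left ?_ (by norm_num)
          exact mul_le_mul hDb h1 (by positivity) (by positivity)
      _ = X0 ^ 5 * (160 * τ ^ 2 + 80 * (q * τ ^ 3)) := by ring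
      _ ≤ X0 ^ 5 * (81 * θ) := by
          refine mul_le_mul_of_nonneg_left ?_ hXn.le
          rw [hθ]; linarith
  · subst h6
    norm_num at hθ
    refine hsuff 241 ((hTC6 rfl).trans ?_) (by have := hK6 rfl; norm_num; linarith)
    have h1 : ρ ^ 4 + L ^ 2 * (N * ρ) ≤ (2 * X0) ^ 4 + (2 * τ * X0) ^ 2 * (q * X0 * (2 * X0)) := by
      refine add_le_add (pow_le_pow_left₀ hρ0 hρ2 4) ?_
      refine mul_le_mul (pow_le_pow_left₀ hL0 hLX 2) ?_ (by positivity) (by positivity)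
      rw [hNX]; exact mul_le_mul_of_nonneg_left hρ2 (by positivity)
    calc 15 * (D * (ρ ^ 4 + L ^ 2 * (N * ρ)))
        ≤ 15 * (2 * τ ^ 2 * X0 ^ 2 * ((2 * X0) ^ 4 + (2 * τ * X0) ^ 2 * (q * X0 * (2 * X0)))) := by
          refine mul_le_mul_of_nonneg_left ?_ (by norm_num)
          exact mul_le_mul hDb h1 (by positivity) (by positivity)
      _ = X0 ^ 6 * (480 * τ ^ 2 + 240 * (q * τ ^ 4)) := by ring
      _ ≤ X0 ^ 6 * (241 * θ) := by
          refine mul_le_mul_of_nonneg_left ?_ hXn.le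
          rw [hθ]; linarith

end FinalPart

section MainPart

lemma cy_K_bound (n : ℕ) (hn : 4 ≤ n) (K : ℝ)
    (hK : K = if n = 4 then 48 else
      36 + 80 * (6 : ℝ) ^ (n / 2 - 2) + 12 * ((n / 2 : ℕ) : ℝ)) :
    2 ^ (n - 1) + 2 ≤ K ∧ (n = 5 → 98 ≤ K) ∧ (n = 6 → 274 ≤ K) := by
  refine ⟨?_, ?_, ?_⟩
  · by_cases h4 : n = 4
    · rw [hK, if_pos h4, h4]; norm_num
    · rw [hK, if_neg h4]
      obtain ⟨j, hj⟩ : ∃ j, n / 2 = j + 2 := ⟨n / 2 - 2, by omega⟩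
      rw [hj]
      have h1 : (2 : ℝ) ^ (n - 1) ≤ 2 ^ (2 * (j + 2)) :=
        pow_le_pow_right₀ (by norm_num) (by omega)
      have h2 : (2 : ℝ) ^ (2 * (j + 2)) = 16 * 4 ^ j := by
        rw [pow_mul, pow_add]; norm_num; ring
      have h3 : (4 : ℝ) ^ j ≤ 6 ^ j := pow_le_pow_left₀ (by norm_num) (by norm_num) j
      have h4 : (0 : ℝ) < 6 ^ j := by positivity
      have h5 : (0 : ℝ) ≤ ((j + 2 : ℕ) : ℝ) := Nat.cast_nonneg _
      simp only [Nat.add_sub_cancel]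
      linarith
  · rintro rfl; rw [hK]; norm_num
  · rintro rfl; rw [hK]; norm_num

lemma cy_expo (n : ℕ) (hn : 4 ≤ n) :
    (if Even n then (((n / 2 : ℕ) : ℝ) - 2) / (((n / 2 : ℕ) : ℝ) - 1)
      else (2 * ((n / 2 : ℕ) : ℝ) - 3) / (2 * ((n / 2 : ℕ) : ℝ) - 1))
      = 1 - 2 / ((n : ℝ) - 2) := by
  split_ifs with h
  · obtain ⟨k, hk⟩ := h
    have h1 : n / 2 = k := by omega
    have hk2 : (2 : ℝ) ≤ k := by exact_mod_cast (by omega : 2 ≤ k)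
    have h3 : (n : ℝ) = 2 * k := by rw [hk]; push_cast; ring
    rw [h1, h3]
    have h4 : (k : ℝ) - 1 ≠ 0 := by linarith
    have h5 : (2 * k : ℝ) - 2 ≠ 0 := by linarith
    rw [div_eq_iff h4]
    have : (2 : ℝ) / (2 * k - 2) = 1 / (k - 1) := by
      rw [div_eq_div_iff h5 h4]; ring
    rw [this, sub_mul, div_mul_cancel₀ _ h4]; ring
  · obtain ⟨k, hk⟩ := Nat.not_even_iff_odd.mp h
    have h1 : n / 2 = k := by omega
    have hk2 : (2 : ℝ) ≤ k := by exact_mod_cast (by omega : 2 ≤ k)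
    have h3 : (n : ℝ) = 2 * k + 1 := by rw [hk]; push_cast; ring
    rw [h1, h3]
    have h4 : 2 * (k : ℝ) - 1 ≠ 0 := by linarith
    have h5 : (2 * k : ℝ) + 1 - 2 = 2 * k - 1 := by ring
    rw [h5, div_eq_iff h4, sub_mul, div_mul_cancel₀ _ h4]; ring

/-- The estimate for one field, with the exponents in normalized form. -/
lemma cy_main {F : Type} [Field F] [Fintype F] (hF : ringChar F ≠ 2)
    (d n : ℕ) (hd : 2 ≤ d) (hn : 4 ≤ n) (δ : ℝ) (hδ0 : 0 < δ) (hδ7 : 7 ≤ n → δ < 1 / 18)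
    (K c : ℝ) (hc : 1 ≤ c)
    (hK : 2 ^ (n - 1) + 2 ≤ K ∧ (n = 5 → 98 ≤ K) ∧ (n = 6 → 274 ≤ K))
    (q : ℝ) (hq : q = Fintype.card F) (hq4 : 4 ≤ q)
    (hq2 : 2 ^ (n + 10) * (n : ℝ) ^ 2 ≤ q ^ (1 / ((n : ℝ) - 2) + δ / 2 - ((n : ℝ) / 2 - 1) * δ))
    (Q : QuadraticForm F (Fin d → F))
    (hQ : ∀ x, (∀ y, QuadraticMap.polar (⇑Q) x y = 0) → x = 0) (t : F) (ht : t ≠ 0)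
    (E : Finset (Fin d → F)) (N : ℝ) (hN : N = E.card)
    (hNq : q ^ (((d : ℝ) + 1) / 2 + 1 / ((n : ℝ) - 2) + δ / 2) ≤ N) :
    |(Nat.card {x : Fin n → (Fin d → F) // Function.Injective x ∧
            (∀ i, x i ∈ E) ∧
            ∀ i : Fin n, Q (x i - x (finRotate n i)) = t} : ℝ) - N ^ n / q ^ n| ≤
      (N ^ n / q ^ n) * (K * q ^ (-((n : ℝ) / 2 - 1) * δ) +
        (2 * (n : ℝ) * q ^ (-(2 / ((n : ℝ) - 1))) +
          c * q ^ (-(((d : ℝ) - 3) / 2) - (2 / ((n : ℝ) - 2) + δ)))) := by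
  have hq0 : 0 < q := by linarith
  have hq1 : 1 ≤ q := by linarith
  have hn4 : (4 : ℝ) ≤ n := by exact_mod_cast hn
  have hn2 : (0 : ℝ) < (n : ℝ) - 2 := by linarith
  have hn2i : (0 : ℝ) < 1 / ((n : ℝ) - 2) := by positivity
  have hN0 : 0 < N := lt_of_lt_of_le (by positivity) hNq
  have hE : E.Nonempty := by
    rw [← Finset.card_pos]
    rw [hN] at hN0
    exact_mod_cast hN0
  set L : ℝ := 2 * Real.sqrt q ^ (d + 1) / q with hL
  obtain ⟨T, hT, hC0, hCT, hTC, hTC5, hTC6⟩ := cy_combine hF Q hQ t ht E hE n hn q N (N / q) L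
    (N / q + L) (q ^ d / q + L) _ hq hN rfl hL rfl rfl rfl
  have hsq : Real.sqrt q ^ (d + 1) = q ^ (((d : ℝ) + 1) / 2) := by
    rw [Real.sqrt_eq_rpow, ← Real.rpow_natCast, ← Real.rpow_mul hq0.le]
    congr 1; push_cast; ring
  set τ : ℝ := q ^ (-(1 / ((n : ℝ) - 2)) - δ / 2) with hτ
  have hτ0 : 0 < τ := by positivity
  have hNτ : q ^ (((d : ℝ) + 1) / 2) ≤ τ * N := by
    calc q ^ (((d : ℝ) + 1) / 2)
        = τ * q ^ (((d : ℝ) + 1) / 2 + 1 / ((n : ℝ) - 2) + δ / 2) := by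
          rw [hτ, ← Real.rpow_add hq0]; congr 1; ring
      _ ≤ τ * N := mul_le_mul_of_nonneg_left hNq hτ0.le
  have hB1' : 0 ≤ 2 * (n : ℝ) * q ^ (-(2 / ((n : ℝ) - 1))) := by positivity
  rw [← div_pow]
  refine cy_numeric d n hd hn q N (N / q) L (N / q + L) (q ^ d / q + L) _ T K
    (q ^ (-((n : ℝ) / 2 - 1) * δ)) τ _ hq4 hN0 rfl (by positivity) rfl rfl hτ0 ?_ ?_ ?_ ?_ ?_ ?_ ?_
    ?_ ?_ hK.1 hK.2.1 hK.2.2 hT hC0 hCT hTC hTC5 hTC6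
  · rw [hL, hsq]
    have : 2 * τ * (N / q) = 2 * (τ * N) / q := by ring
    rw [this]
    gcongr
  · rw [hτ, ← Real.rpow_natCast, ← Real.rpow_mul hq0.le]
    nth_rewrite 1 [← Real.rpow_one q]
    rw [← Real.rpow_add hq0]
    congr 1
    rw [Nat.cast_sub (by omega)]
    push_cast
    field_simp
    ring
  · calc 2 ^ (n + 10) * (n : ℝ) ^ 2 * τ
        ≤ q ^ (1 / ((n : ℝ) - 2) + δ / 2 - ((n : ℝ) / 2 - 1) * δ) * τ :=
          mul_le_mul_of_nonneg_right hq2 hτ0.le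
      _ = q ^ (-((n : ℝ) / 2 - 1) * δ) := by
          rw [hτ, ← Real.rpow_add hq0]; congr 1; ring
  · refine Real.rpow_le_one_of_one_le_of_nonpos hq1 ?_
    have : 0 ≤ ((n : ℝ) / 2 - 1) * δ := mul_nonneg (by linarith) hδ0.le
    linarith
  · intro h3
    have h3' : (3 : ℝ) ≤ d := by exact_mod_cast h3
    have h4 : q ^ (2 : ℝ) ≤ q ^ (((d : ℝ) + 1) / 2) :=
      Real.rpow_le_rpow_of_exponent_le hq1 (by linarith)
    have h5 : τ * (N / q) = τ * N / q := by ring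
    rw [h5, le_div_iff₀ hq0]
    rw [Real.rpow_two] at h4
    nlinarith
  · rintro rfl
    have h5 : Real.sqrt q ^ 2 = q := Real.sq_sqrt hq0.le
    have : L = 2 * Real.sqrt q := by
      rw [hL, pow_succ, h5]; field_simp
    rw [this, mul_pow, h5]; norm_num
  · rintro ⟨rfl, rfl⟩
    have h1 : (E.card : ℝ) ≤ q ^ 2 := by
      have : E.card ≤ Fintype.card F ^ 2 := by
        refine (Finset.card_le_univ E).trans ?_
        simp
      rw [hq]; exact_mod_cast this
    have h2 : q ^ (2 : ℝ) < q ^ ((((2 : ℕ) : ℝ) + 1) / 2 + 1 / (((4 : ℕ) : ℝ) - 2) + δ / 2) := by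
      refine Real.rpow_lt_rpow_of_exponent_lt (by linarith) ?_
      norm_num
      linarith
    rw [Real.rpow_two] at h2
    rw [← hN] at h1
    linarith
  · positivity
  · rintro rfl h7
    have h7' : (7 : ℝ) ≤ n := by exact_mod_cast h7
    have h8 : 2 / ((n : ℝ) - 2) ≤ 2 / 5 := by
      apply div_le_div_of_nonneg_left <;> linarith
    have h9 := hδ7 h7
    have h10 : 1 ≤ q ^ (-((((2 : ℕ) : ℝ) - 3) / 2) - (2 / ((n : ℝ) - 2) + δ)) := by
      refine Real.one_le_rpow hq1 ?_
      push_cast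
      linarith
    have := one_le_mul_of_one_le_of_one_le hc h10
    linarith

end MainPart

/-- Counting non-degenerate `n`-cycles (`n ≥ 4`, pairwise distinct
vertices) for sufficiently large odd `q`.  Here `k = ⌊n/2⌋ = n / 2` (natural division),
and `finRotate n i = i + 1` cyclically. -/
theorem stmt15 (d n : ℕ) (hd : 2 ≤ d) (hn : 4 ≤ n)
    (δ : ℝ) (hδ0 : 0 < δ) (hδ : δ < 1 / (2 * ((n / 2 : ℕ) : ℝ) ^ 2))
    (K c ε : ℝ)
    (hK : K = if n = 4 then 48 else
      36 + 80 * (6 : ℝ) ^ (n / 2 - 2) + 12 * ((n / 2 : ℕ) : ℝ))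
    (hc : c = ((n - 1 : ℕ) : ℝ) ^ (n - 3) * (2 : ℝ) ^ ((n - 1) * (n - 2) / 2 + 3 - n))
    (hε : ε = if Even n then
        1 - (((n / 2 : ℕ) : ℝ) - 2) / (((n / 2 : ℕ) : ℝ) - 1) + δ
      else
        1 - (2 * ((n / 2 : ℕ) : ℝ) - 3) / (2 * ((n / 2 : ℕ) : ℝ) - 1) + δ) :
    ∃ Q₀ : ℕ, ∀ (F : Type) [Field F] [Fintype F],
      Q₀ ≤ Fintype.card F → Odd (Fintype.card F) →
      ∀ Q : QuadraticForm F (Fin d → F),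
        (∀ x, (∀ y, QuadraticMap.polar (⇑Q) x y = 0) → x = 0) →
      ∀ t : F, t ≠ 0 →
      ∀ E : Finset (Fin d → F),
        (if Even n then
            (E.card : ℝ) ≥ (Fintype.card F : ℝ) ^
              ((1 / 2 : ℝ) * ((d : ℝ) + 2 -
                (((n / 2 : ℕ) : ℝ) - 2) / (((n / 2 : ℕ) : ℝ) - 1) + δ))
          else
            (E.card : ℝ) ≥ (Fintype.card F : ℝ) ^
              ((1 / 2 : ℝ) * ((d : ℝ) + 2 -
                (2 * ((n / 2 : ℕ) : ℝ) - 3) / (2 * ((n / 2 : ℕ) : ℝ) - 1) + δ))) →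
        |(Nat.card {x : Fin n → (Fin d → F) // Function.Injective x ∧
            (∀ i, x i ∈ E) ∧
            ∀ i : Fin n, Q (x i - x (finRotate n i)) = t} : ℝ) -
            (E.card : ℝ) ^ n / (Fintype.card F : ℝ) ^ n| ≤
          ((E.card : ℝ) ^ n / (Fintype.card F : ℝ) ^ n) *
            (K * (Fintype.card F : ℝ) ^ (-((n : ℝ) / 2 - 1) * δ) +
              2 * (n : ℝ) * (Fintype.card F : ℝ) ^ (-(2 / ((n : ℝ) - 1))) +
              c * (Fintype.card F : ℝ) ^ (-(((d : ℝ) - 3) / 2) - ε)) := by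
  have hn4 : (4 : ℝ) ≤ n := by exact_mod_cast hn
  have hn2 : (0 : ℝ) < (n : ℝ) - 2 := by linarith
  have hk2 : (2 : ℝ) ≤ ((n / 2 : ℕ) : ℝ) := by exact_mod_cast (by omega : 2 ≤ n / 2)
  have hnk : (n : ℝ) ≤ 2 * ((n / 2 : ℕ) : ℝ) + 1 := by exact_mod_cast (by omega : n ≤ 2 * (n / 2) + 1)
  have hex := cy_expo n hn
  have hKb := cy_K_bound n hn K hK
  have hc1 : 1 ≤ c := by
    rw [hc]
    refine one_le_mul_of_one_le_of_one_le (one_le_pow₀ ?_) (one_le_pow₀ (by norm_num))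
    exact_mod_cast (by omega : 1 ≤ n - 1)
  have hε' : ε = 2 / ((n : ℝ) - 2) + δ := by
    split_ifs at hε hex with h <;> rw [hε, hex] <;> ring
  have hδk : δ * (2 * ((n / 2 : ℕ) : ℝ) ^ 2) < 1 := by
    rwa [lt_div_iff₀ (by positivity)] at hδ
  have hδ7 : 7 ≤ n → δ < 1 / 18 := by
    intro h7
    have h3 : (3 : ℝ) ≤ ((n / 2 : ℕ) : ℝ) := by exact_mod_cast (by omega : 3 ≤ n / 2)
    have h9 : (9 : ℝ) ≤ ((n / 2 : ℕ) : ℝ) ^ 2 := by nlinarith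
    nlinarith
  have hκ : 0 < 1 / ((n : ℝ) - 2) + δ / 2 - ((n : ℝ) / 2 - 1) * δ := by
    have h1 : ((n : ℝ) - 2) ^ 2 ≤ (2 * ((n / 2 : ℕ) : ℝ)) ^ 2 :=
      pow_le_pow_left₀ hn2.le (by linarith) 2
    have h2 : δ * ((n : ℝ) - 2) ^ 2 ≤ δ * (2 * ((n / 2 : ℕ) : ℝ)) ^ 2 :=
      mul_le_mul_of_nonneg_left h1 hδ0.le
    have h3 : ((n : ℝ) / 2 - 1) * δ < 1 / ((n : ℝ) - 2) := by
      rw [lt_div_iff₀ hn2]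
      linarith
    linarith
  obtain ⟨R, hR⟩ := Filter.eventually_atTop.mp
    ((tendsto_rpow_atTop hκ).eventually_ge_atTop (2 ^ (n + 10) * (n : ℝ) ^ 2))
  refine ⟨max 4 ⌈R⌉₊, ?_⟩
  intro F _ _ hcard hodd Q hQ t ht E hE
  have hq4 : (4 : ℝ) ≤ (Fintype.card F : ℝ) := by exact_mod_cast (le_max_left _ _).trans hcard
  have hqR : R ≤ (Fintype.card F : ℝ) :=
    (Nat.le_ceil R).trans (by exact_mod_cast (le_max_right _ _).trans hcard)
  have hF : ringChar F ≠ 2 := by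
    intro h
    have h1 := FiniteField.even_card_iff_char_two.mp h
    have h2 := Nat.odd_iff.mp hodd
    omega
  have hNq : (Fintype.card F : ℝ) ^ (((d : ℝ) + 1) / 2 + 1 / ((n : ℝ) - 2) + δ / 2) ≤
      (E.card : ℝ) := by
    split_ifs at hE hex with h <;> rw [hex] at hE <;>
    · convert hE using 2
      ring
  have hfin := cy_main hF d n hd hn δ hδ0 hδ7 K c hc1 hKb (Fintype.card F : ℝ) rfl hq4
    (hR _ hqR) Q hQ t ht E (E.card : ℝ) rfl hNq
  rw [hε', add_assoc (K * _)]
  exact hfin
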